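/- arXiv:1810.07575 — 4 statements merged into one kernel-verified Lean document; each statement's English description precedes it below -/
import Mathlib

section
/- The class of all IP loops has the Finite Embedding Property: for every IP loop (G,·) and every finite nonempty subset X ⊆ G, there exist a finite IP loop (H,*) and an injective map φ : X → H such that φ(x·y) = φ(x) * φ(y) for all x, y ∈ X with x·y ∈ X. -/
/-- A loop with the inverse property (IP loop): a set with a binary operation `*`,
a two-sided unit `1` such that the equations `a * x = b` and `y * a = b` have
unique solutions, together with two-sided inverses satisfying the inverse
property identities `x⁻¹ * (x * y) = y = (y * x) * x⁻¹`. -/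
class IPLoop (α : Type*) extends Mul α, One α, Inv α where
  one_mul : ∀ x : α, 1 * x = x
  mul_one : ∀ x : α, x * 1 = x
  existsUnique_left : ∀ a b : α, ∃! x : α, a * x = b
  existsUnique_right : ∀ a b : α, ∃! y : α, y * a = b
  mul_inv : ∀ x : α, x * x⁻¹ = 1
  inv_mul : ∀ x : α, x⁻¹ * x = 1
  ip_left : ∀ x y : α, x⁻¹ * (x * y) = y
  ip_right : ∀ x y : α, (y * x) * x⁻¹ = y

/-- A loop with two-sided inverses whose inversion is an antiautomorphism; only left cancellation
is required, since on finite carriers it implies all the other loop laws. -/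
structure AntiInverseLoop (Q : Type*) where
  mul : Q → Q → Q
  inv : Q → Q
  one : Q
  one_mul : ∀ x, mul one x = x
  mul_one : ∀ x, mul x one = x
  mul_inv : ∀ x, mul x (inv x) = one
  inv_inv : ∀ x, inv (inv x) = x
  inv_mul : ∀ x y, inv (mul x y) = mul (inv y) (inv x)
  mul_left_cancel : ∀ x y z, mul x y = mul x z → y = z

namespace AntiInverseLoop

variable {Q : Type*} (L : AntiInverseLoop Q)

theorem inv_injective : Function.Injective L.inv :=
  Function.LeftInverse.injective L.inv_inv

theorem mul_right_cancel (x y z : Q) (h : L.mul y x = L.mul z x) : y = z := by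
  apply L.inv_injective
  apply L.mul_left_cancel (L.inv x)
  rw [← L.inv_mul, ← L.inv_mul, h]

theorem inv_one : L.inv L.one = L.one := by
  rw [← L.one_mul (L.inv L.one), L.mul_inv]

theorem inv_mul_self (x : Q) : L.mul (L.inv x) x = L.one := by
  simpa [L.inv_inv] using L.mul_inv (L.inv x)

theorem inv_eq_one {x : Q} : L.inv x = L.one ↔ x = L.one :=
  ⟨fun h => by rw [← L.inv_inv x, h, L.inv_one], fun h => by rw [h, L.inv_one]⟩

theorem mul_eq_one {x y : Q} : L.mul x y = L.one ↔ y = L.inv x :=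
  ⟨fun h => L.mul_left_cancel x _ _ (h.trans (L.mul_inv x).symm), fun h => h ▸ L.mul_inv x⟩

theorem mul_eq_left {x y : Q} : L.mul x y = x ↔ y = L.one :=
  ⟨fun h => L.mul_left_cancel x _ _ (h.trans (L.mul_one x).symm), fun h => h ▸ L.mul_one x⟩

/-- The inverse property holds for the factors of the product of `x` and `y`. -/
def Good (x y : Q) : Prop :=
  L.mul (L.mul x y) (L.inv y) = x ∧ L.mul (L.inv x) (L.mul x y) = y

theorem Good.inv_left {x y : Q} (h : L.Good x y) : L.Good (L.inv x) (L.mul x y) := by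
  refine ⟨?_, by rw [h.2, L.inv_inv]⟩
  rw [h.2, L.inv_mul]
  have h1 := congrArg L.inv h.1
  rwa [L.inv_mul, L.inv_inv, L.inv_mul] at h1

theorem Good.of_inv_left {x w : Q} (h : L.Good (L.inv x) w) :
    L.Good x (L.mul (L.inv x) w) := by
  simpa only [L.inv_inv] using h.inv_left

theorem good_mul_iff {x y : Q} : L.Good (L.inv x) (L.mul x y) ↔ L.Good x y := by
  refine ⟨fun h => ?_, Good.inv_left L⟩
  have h2 := h.2
  rw [L.inv_inv] at h2
  have h3 := L.mul_left_cancel _ _ _ h2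
  simpa only [h3] using h.of_inv_left

theorem good_inv_iff {x y : Q} : L.Good (L.inv y) (L.inv x) ↔ L.Good x y := by
  unfold Good
  simp only [L.inv_inv, ← L.inv_mul]
  rw [and_comm]
  constructor
  · rintro ⟨h1, h2⟩
    refine ⟨L.inv_injective ?_, L.inv_injective ?_⟩
    · rw [L.inv_mul, L.inv_inv, h1]
    · rw [L.inv_mul, L.inv_inv, h2]
  · rintro ⟨h1, h2⟩
    refine ⟨?_, ?_⟩
    · simpa [L.inv_mul, L.inv_inv] using congrArg L.inv h1
    · simpa [L.inv_mul, L.inv_inv] using congrArg L.inv h2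

open Classical in
/-- Inversion on the threefold cover `Q × ZMod 3`. -/
noncomputable def coverInv (a : Q × ZMod 3) : Q × ZMod 3 :=
  (L.inv a.1, if a.1 = L.one then -a.2 else a.2)

theorem coverInv_coverInv (a : Q × ZMod 3) : L.coverInv (L.coverInv a) = a := by
  obtain ⟨x, i⟩ := a
  by_cases h : x = L.one <;> simp [coverInv, h, L.inv_inv, L.inv_eq_one]

variable [Finite Q]

theorem exists_mul_eq (x y : Q) : ∃ w, L.mul x w = y :=
  Finite.surjective_of_injective (fun _ _ h => L.mul_left_cancel x _ _ h) y

/-- The solution `w` of `x * w = y`. -/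
noncomputable def leftDiv (x y : Q) : Q := (L.exists_mul_eq x y).choose

theorem mul_leftDiv (x y : Q) : L.mul x (L.leftDiv x y) = y := (L.exists_mul_eq x y).choose_spec

theorem leftDiv_mul (x y : Q) : L.leftDiv x (L.mul x y) = y :=
  L.mul_left_cancel x _ _ (L.mul_leftDiv x _)

theorem leftDiv_eq_iff {x y w : Q} : L.leftDiv x y = w ↔ L.mul x w = y :=
  ⟨fun h => h ▸ L.mul_leftDiv x y, fun h => h ▸ L.leftDiv_mul x w⟩

/-- The solution `w` of `w * y = x`. -/
noncomputable def rightDiv (x y : Q) : Q := L.inv (L.leftDiv (L.inv y) (L.inv x))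

theorem rightDiv_mul (x y : Q) : L.mul (L.rightDiv x y) y = x := by
  apply L.inv_injective
  rw [L.inv_mul, rightDiv, L.inv_inv, L.mul_leftDiv]

theorem rightDiv_eq_iff {x y w : Q} : L.rightDiv x y = w ↔ L.mul w y = x :=
  ⟨fun h => h ▸ L.rightDiv_mul x y, fun h => L.mul_right_cancel y _ _ (by rw [L.rightDiv_mul, h])⟩

open Classical in
/-- Multiplication on the threefold cover `Q × ZMod 3`: good pairs are multiplied by a rule which
preserves the zero level, and the remaining ones by the Bose construction. -/
noncomputable def coverMul (a b : Q × ZMod 3) : Q × ZMod 3 :=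
  if a.1 = L.one then (b.1, a.2 + b.2)
  else if b.1 = L.one then (a.1, a.2 - b.2)
  else if b.1 = L.inv a.1 then (L.one, a.2 - b.2)
  else if L.Good a.1 b.1 then (L.mul a.1 b.1, -(a.2 + b.2))
  else if b.2 = a.2 then (L.mul a.1 b.1, a.2 + 1)
  else if b.2 = a.2 + 1 then (L.leftDiv (L.inv a.1) b.1, a.2)
  else (L.rightDiv a.1 (L.inv b.1), b.2)

theorem ne_add_one_add_one : ∀ i : ZMod 3, i ≠ i + 1 + 1 := by decide

theorem coverMul_inv_left (a b : Q × ZMod 3) :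
    L.coverMul (L.coverInv a) (L.coverMul a b) = b := by
  obtain ⟨x, i⟩ := a
  obtain ⟨y, j⟩ := b
  by_cases hx : x = L.one
  · simp [coverMul, coverInv, hx, L.inv_one]
  have hx' : L.inv x ≠ L.one := fun h => hx (L.inv_eq_one.1 h)
  by_cases hy : y = L.one
  · simp [coverMul, coverInv, hx, hx', hy, L.inv_inv]
  by_cases hxy : y = L.inv x
  · simp [coverMul, coverInv, hx, hx', hxy]
  have h1 : L.mul x y ≠ L.one := fun h => hxy (L.mul_eq_one.1 h)
  have h2 : L.mul x y ≠ x := fun h => hy (L.mul_eq_left.1 h)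
  by_cases hg : L.Good x y
  · simp [coverMul, coverInv, hx, hx', hy, hxy, hg, L.inv_inv, h1, h2, hg.inv_left, hg.2]
  by_cases hij : j = i
  · simp [coverMul, coverInv, hx, hx', hy, hxy, hg, L.inv_inv, h1, h2, L.good_mul_iff, hij,
      L.leftDiv_mul]
  by_cases hij' : j = i + 1
  · have hw := L.mul_leftDiv (L.inv x) y
    set w := L.leftDiv (L.inv x) y with hwdef
    have h3 : w ≠ L.one := fun h => hxy (by rw [← hw, h, L.mul_one])
    have h4 : w ≠ x := fun h => hy (by rw [← hw, h, L.inv_mul_self])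
    have h5 : ¬ L.Good (L.inv x) w := fun h => hg (hw ▸ h.of_inv_left)
    simp [coverMul, coverInv, hx, hx', hy, hxy, hg, hij', ← hwdef, L.inv_inv, h3, h4, h5, hw]
  · have hw := L.rightDiv_mul x (L.inv y)
    set w := L.rightDiv x (L.inv y) with hwdef
    have h3 : w ≠ L.one := fun h => hxy (by rw [← hw, h, L.one_mul, L.inv_inv])
    have h4 : w ≠ x := fun h => hy (by rwa [h, L.mul_eq_left, L.inv_eq_one] at hw)
    have h6 : L.mul y (L.inv w) = L.inv x := by rw [← hw, L.inv_mul, L.inv_inv]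
    have h5 : ¬ L.Good (L.inv x) w := fun h =>
      hg (L.mul_right_cancel _ _ _ (h.1.trans h6.symm) ▸ h.of_inv_left)
    have h7 : i ≠ j := fun h => hij h.symm
    have h8 : i = j + 1 := by revert i j; decide
    have h9 : j ≠ j + 1 + 1 := ne_add_one_add_one j
    have h10 : L.rightDiv (L.inv x) (L.inv w) = y := L.rightDiv_eq_iff.2 h6
    simp [coverMul, coverInv, hx, hx', hy, hxy, hg, ← hwdef, L.inv_inv, h3, h4, h5, h8,
      h9, h10]

theorem coverInv_coverMul (a b : Q × ZMod 3) :
    L.coverInv (L.coverMul a b) = L.coverMul (L.coverInv b) (L.coverInv a) := by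
  obtain ⟨x, i⟩ := a
  obtain ⟨y, j⟩ := b
  by_cases hx : x = L.one
  · by_cases hy : y = L.one
    · simp [coverMul, coverInv, hx, hy, L.inv_one, add_comm]
    · simp [coverMul, coverInv, hx, hy, L.inv_one, L.inv_eq_one, add_comm]
  have hx' : L.inv x ≠ L.one := fun h => hx (L.inv_eq_one.1 h)
  by_cases hy : y = L.one
  · simp [coverMul, coverInv, hx, hy, L.inv_one, sub_eq_neg_add]
  have hy' : L.inv y ≠ L.one := fun h => hy (L.inv_eq_one.1 h)
  by_cases hxy : y = L.inv x
  · simp [coverMul, coverInv, hx, hx', hxy, L.inv_inv, L.inv_one]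
  have h0 : L.inv x ≠ y := fun h => hxy h.symm
  have h1 : L.mul x y ≠ L.one := fun h => hxy (L.mul_eq_one.1 h)
  by_cases hg : L.Good x y
  · simp [coverMul, coverInv, hx, hx', hy, hy', hxy, h0, hg, L.inv_inv, h1, L.good_inv_iff,
      L.inv_mul, add_comm]
  by_cases hij : j = i
  · simp [coverMul, coverInv, hx, hx', hy, hy', hxy, h0, hg, L.inv_inv, h1, L.good_inv_iff, hij,
      L.inv_mul]
  have h7 : i ≠ j := fun h => hij h.symm
  by_cases hij' : j = i + 1
  · have hw := L.mul_leftDiv (L.inv x) y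
    set w := L.leftDiv (L.inv x) y with hwdef
    have h3 : w ≠ L.one := fun h => hxy (by rw [← hw, h, L.mul_one])
    have h9 : i ≠ i + 1 + 1 := ne_add_one_add_one i
    have h10 : L.rightDiv (L.inv y) x = L.inv w :=
      L.rightDiv_eq_iff.2 (by rw [← hw, L.inv_mul, L.inv_inv])
    simp [coverMul, coverInv, hx, hx', hy, hy', hxy, h0, hg, hij', ← hwdef, L.inv_inv, h3,
      L.good_inv_iff, h9, h10]
  · have hw := L.rightDiv_mul x (L.inv y)
    set w := L.rightDiv x (L.inv y) with hwdef
    have h3 : w ≠ L.one := fun h => hxy (by rw [← hw, h, L.one_mul, L.inv_inv])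
    have h8 : i = j + 1 := by revert i j; decide
    have h9 : j ≠ j + 1 + 1 := ne_add_one_add_one j
    have h10 : L.leftDiv y (L.inv x) = L.inv w :=
      L.leftDiv_eq_iff.2 (by rw [← hw, L.inv_mul, L.inv_inv])
    simp [coverMul, coverInv, hx, hx', hy, hy', hxy, h0, hg, ← hwdef, L.inv_inv,
      L.good_inv_iff, h3, h8, h9, h10]

theorem coverMul_inv_right (a b : Q × ZMod 3) :
    L.coverMul (L.coverMul b a) (L.coverInv a) = b := by
  have h := congrArg L.coverInv (L.coverMul_inv_left (L.coverInv a) (L.coverInv b))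
  simpa only [L.coverInv_coverMul, L.coverInv_coverInv] using h

/-- The threefold cover of a finite loop with antiautomorphic inverses is an IP loop. -/
@[reducible] noncomputable def coverIPLoop : IPLoop (Q × ZMod 3) where
  mul := L.coverMul
  one := (L.one, 0)
  inv := L.coverInv
  one_mul a := show L.coverMul (L.one, 0) a = a by simp [coverMul]
  mul_one a := show L.coverMul a (L.one, 0) = a by
    obtain ⟨x, i⟩ := a
    by_cases hx : x = L.one <;> simp [coverMul, hx]
  existsUnique_left a b := by
    refine ⟨L.coverMul (L.coverInv a) b, ?_, fun x hx => ?_⟩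
    · have h := L.coverMul_inv_left (L.coverInv a) b
      rwa [L.coverInv_coverInv] at h
    · rw [← show L.coverMul a x = b from hx, L.coverMul_inv_left]
  existsUnique_right a b := by
    refine ⟨L.coverMul b (L.coverInv a), ?_, fun x hx => ?_⟩
    · have h := L.coverMul_inv_right (L.coverInv a) b
      rwa [L.coverInv_coverInv] at h
    · rw [← show L.coverMul x a = b from hx, L.coverMul_inv_right]
  mul_inv a := show L.coverMul a (L.coverInv a) = (L.one, 0) by
    obtain ⟨x, i⟩ := a
    by_cases hx : x = L.one <;> simp [coverMul, coverInv, hx, L.inv_one, L.inv_eq_one]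
  inv_mul a := show L.coverMul (L.coverInv a) a = (L.one, 0) by
    obtain ⟨x, i⟩ := a
    by_cases hx : x = L.one <;> simp [coverMul, coverInv, hx, L.inv_one, L.inv_eq_one, L.inv_inv]
  ip_left := L.coverMul_inv_left
  ip_right x y := L.coverMul_inv_right x y

theorem coverMul_zero {x y : Q} (h : L.Good x y) :
    L.coverMul (x, 0) (y, 0) = (L.mul x y, 0) := by
  by_cases hx : x = L.one
  · simp [coverMul, hx, L.one_mul]
  by_cases hy : y = L.one
  · simp [coverMul, hx, hy, L.mul_one]
  by_cases hxy : y = L.inv x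
  · simp [coverMul, hx, hxy, L.mul_inv, L.inv_eq_one]
  · simp [coverMul, hx, hy, hxy, h]

/-- The loop whose division table `x * y⁻¹` is the array `g`. -/
def ofArray {V : Type*} (g : V → V → V) (J : V → V) (o : V)
    (g_swap : ∀ p q, g q p = J (g p q)) (g_unit : ∀ p, g p o = p) (g_self : ∀ p, g p p = o)
    (g_inj : ∀ p, Function.Injective (g p)) : AntiInverseLoop V :=
  have J_J : ∀ p, J (J p) = p := fun p => by
    conv_lhs => rw [← g_unit p]
    rw [← g_swap, ← g_swap, g_unit]
  { mul := fun x y => g x (J y)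
    inv := J
    one := o
    one_mul := fun x => by rw [g_swap (J x), g_unit, J_J]
    mul_one := fun x => by rw [← g_self o, ← g_swap, g_self, g_unit]
    mul_inv := fun x => by rw [J_J, g_self]
    inv_inv := J_J
    inv_mul := fun x y => by rw [← g_swap, J_J]
    mul_left_cancel := fun x y z h => Function.LeftInverse.injective J_J (g_inj x h) }

end AntiInverseLoop

section Array

variable {Y C : Type*} [AddCommGroup Y] [AddCommGroup C] (d : Y → Y → C) (ι : C → C)

open Classical in
/-- The colour of the arc joining the copies of `(x, 0)` and `(x, c)`: it avoids the
colours `d x u`. -/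
noncomputable def loopColor (x : Y) (c : C) : Y × C × Bool :=
  if h : ∃ u, d x u = c then (h.choose, 0, false) else (0, c, true)

open Classical in
/-- The colour of a reversed arc. -/
noncomputable def colorInv : Y × C × Bool → Y × C × Bool
  | (t, h, true) => if t = 0 then (t, ι h, true) else (t, h, true)
  | (t, h, false) => if h = 0 then (t, h, false) else (-t, -h, false)

open Classical in
/-- Two copies of `Y × C`, whose arcs are coloured in such a way that the arc from `(x, 0)` to
`(y, 0)` in the first copy gets the colour `d x y`. -/
noncomputable def arcColor : Y × C × Bool → Y × C × Bool → Y × C × Bool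
  | (x, b, i), (y, b', j) =>
    if i = j then
      if b = b' then (0, if i then d y x else d x y, true) else (y - x, b' - b, false)
    else if x = y then
      if i then colorInv ι (loopColor d x (b - b')) else loopColor d x (b' - b)
    else if i then (x - y, b - b', true) else (y - x, b' - b, true)

variable {d ι}

theorem colorInv_colorInv (ι_ι : ∀ c, ι (ι c) = c) (p : Y × C × Bool) :
    colorInv ι (colorInv ι p) = p := by
  obtain ⟨t, h, _ | _⟩ := p
  · by_cases hh : h = 0 <;> simp [colorInv, hh]
  · by_cases hh : t = 0 <;> simp [colorInv, hh, ι_ι]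

theorem arcColor_swap (ι_ι : ∀ c, ι (ι c) = c) (d_swap : ∀ x y, d y x = ι (d x y))
    (p q : Y × C × Bool) : arcColor d ι q p = colorInv ι (arcColor d ι p q) := by
  obtain ⟨x, b, i⟩ := p
  obtain ⟨y, b', j⟩ := q
  by_cases hij : i = j
  · subst hij
    by_cases hb : b = b'
    · cases i <;> simp [arcColor, colorInv, hb, ← d_swap]
    · have hb' : b' ≠ b := fun h => hb h.symm
      simp [arcColor, colorInv, hb, hb', sub_eq_zero]
  by_cases hxy : x = y
  · subst hxy
    cases i <;> cases j <;> simp at hij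
    · simp [arcColor]
    · simp [arcColor, colorInv_colorInv ι_ι]
  · have hyx : y ≠ x := fun h => hxy h.symm
    cases i <;> cases j <;> simp at hij <;> simp [arcColor, colorInv, hxy, hyx, sub_eq_zero]

theorem arcColor_injective (ι_ι : ∀ c, ι (ι c) = c) (d_swap : ∀ x y, d y x = ι (d x y))
    (d_inj : ∀ x, Function.Injective (d x)) (p : Y × C × Bool) :
    Function.Injective (arcColor d ι p) := by
  have ι_inj : Function.Injective ι := Function.LeftInverse.injective ι_ι
  obtain ⟨x, b, i⟩ := p
  rintro ⟨y, b₁, j⟩ ⟨z, b₂, k⟩ h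
  have key : ∀ c₁ c₂ (h₁ : ∃ u, d x u = c₁) (h₂ : ∃ u, d x u = c₂), h₁.choose = h₂.choose →
      c₁ = c₂ := fun c₁ c₂ h₁ h₂ h => by rw [← h₁.choose_spec, ← h₂.choose_spec, h]
  have dx : ∀ y z, d x y = d x z → y = z := fun y z h => d_inj x h
  cases i <;> cases j <;> cases k <;>
    simp only [arcColor, loopColor, ↓reduceIte, eq_self, Bool.false_eq_true, reduceCtorEq] at h <;>
    split_ifs at h <;>
    simp only [colorInv, ↓reduceIte, Prod.mk.injEq, reduceCtorEq, and_true, and_false,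
      true_and] at h ⊢ <;>
    try grind

theorem arcColor_bijective_source [Finite Y] [Finite C] (ι_ι : ∀ c, ι (ι c) = c)
    (d_swap : ∀ x y, d y x = ι (d x y)) (d_inj : ∀ x, Function.Injective (d x))
    (q : Y × C × Bool) : Function.Bijective fun p => arcColor d ι p q := by
  refine Finite.injective_iff_bijective.1 fun p p' h => ?_
  have h' : arcColor d ι p q = arcColor d ι p' q := h
  rw [arcColor_swap ι_ι d_swap q p, arcColor_swap ι_ι d_swap q p'] at h'
  exact arcColor_injective ι_ι d_swap d_inj q
    (Function.LeftInverse.injective (colorInv_colorInv ι_ι) h')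

theorem arcColor_base (x y : Y) : arcColor d ι (x, 0, false) (y, 0, false) = (0, d x y, true) := by
  simp [arcColor]

/-- A partial division table `d` on `Y` extends to a finite loop with antiautomorphic inverses. -/
theorem exists_antiInverseLoop [Finite Y] [Finite C] (ι_ι : ∀ c, ι (ι c) = c)
    (d_swap : ∀ x y, d y x = ι (d x y)) (d_inj : ∀ x, Function.Injective (d x)) (e : Y)
    (d_self : ∀ x, d x x = d e e) :
    ∃ L : AntiInverseLoop (Y × C × Bool),
      (∀ x y, d e x = d y e → L.inv (x, 0, false) = (y, 0, false)) ∧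
      ∀ x y z, d x y = d z e →
        L.mul (x, 0, false) (L.inv (y, 0, false)) = (z, 0, false) := by
  let o : Y × C × Bool := (e, 0, false)
  let ν := Equiv.ofBijective _ (arcColor_bijective_source ι_ι d_swap d_inj o)
  have hν : ∀ p, ν p = arcColor d ι p o := fun _ => rfl
  let g p q := ν.symm (arcColor d ι p q)
  let J p := ν.symm (colorInv ι (ν p))
  have g_base : ∀ x y z, d x y = d z e → g (x, 0, false) (y, 0, false) = (z, 0, false) :=
    fun x y z h => by
      rw [Equiv.symm_apply_eq, hν, arcColor_base, arcColor_base, h]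
  have J_J : ∀ p, J (J p) = p := fun p => by simp [J, colorInv_colorInv ι_ι]
  have arc_self : ∀ p, arcColor d ι p p = (0, d e e, true) := fun ⟨x, b, i⟩ => by
    cases i <;> simp [arcColor, d_self x]
  have g_swap : ∀ p q, g q p = J (g p q) := fun p q => by
    simp [g, J, arcColor_swap ι_ι d_swap p q]
  have g_unit : ∀ p, g p o = p := fun p => by simp [g, ← hν]
  let L := AntiInverseLoop.ofArray g J o g_swap g_unit
    (fun p => by rw [Equiv.symm_apply_eq, hν, arc_self, arc_self])
    (fun p => ν.symm.injective.comp (arcColor_injective ι_ι d_swap d_inj p))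
  refine ⟨L, fun x y h => ?_, fun x y z h => ?_⟩
  · change J (x, 0, false) = _
    rw [← g_base e x y h, g_swap, g_unit (x, 0, false)]
  · change g (x, 0, false) (J (J (y, 0, false))) = _
    rw [J_J, g_base x y z h]

end Array

namespace IPLoop

variable {G : Type*} [IPLoop G]

theorem inv_eq_of_mul_eq_one {x y : G} (h : x * y = 1) : x⁻¹ = y := by
  rw [← ip_left x y, h, mul_one]

theorem inv_inv (x : G) : x⁻¹⁻¹ = x := inv_eq_of_mul_eq_one (inv_mul x)

theorem one_inv : (1 : G)⁻¹ = 1 := inv_eq_of_mul_eq_one (mul_one 1)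

theorem mul_inv_rev (x y : G) : (x * y)⁻¹ = y⁻¹ * x⁻¹ := by
  have h : y * (x * y)⁻¹ = x⁻¹ := by
    have h := ip_right (x * y) x⁻¹
    rwa [ip_left] at h
  rw [← h, ip_left]

theorem mul_left_cancel {x y z : G} (h : x * y = x * z) : y = z := by
  rw [← ip_left x y, h, ip_left]

theorem inv_injective : Function.Injective (fun x : G => x⁻¹) :=
  Function.LeftInverse.injective inv_inv

theorem mul_inv_cancel (x y : G) : x * y * y⁻¹ = x := ip_right y x

end IPLoop

/-- The class of all IP loops has the Finite Embedding Property: for every IP loop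
`G` and every finite nonempty subset `X ⊆ G` there is a finite IP loop `H` and an
injective map `φ : X → H` preserving all products of elements of `X` that lie in `X`. -/
theorem ipLoop_finiteEmbeddingProperty {G : Type*} [IPLoop G]
    (X : Set G) (hXfin : X.Finite) (hXne : X.Nonempty) :
    ∃ (H : Type) (iH : IPLoop H) (_ : Fintype H) (φ : G → H),
      Set.InjOn φ X ∧
      ∀ x ∈ X, ∀ y ∈ X, x * y ∈ X → φ (x * y) = iH.toMul.mul (φ x) (φ y) := by
  classical
  let Y : Set G := insert 1 (X ∪ (fun x => x⁻¹) '' X)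
  have hY : Y.Finite := (hXfin.union (hXfin.image _)).insert 1
  have hXY : ∀ x ∈ X, x ∈ Y := fun x hx => Or.inr (Or.inl hx)
  have hYinv : ∀ x ∈ Y, x⁻¹ ∈ Y := by
    rintro _ (rfl | hx | ⟨x, hx, rfl⟩)
    · exact Or.inl IPLoop.one_inv
    · exact Or.inr (Or.inr ⟨_, hx, rfl⟩)
    · simpa only [IPLoop.inv_inv] using hXY x hx
  let C : Set G := Set.image2 (fun x y => x * y⁻¹) Y Y
  have hC : C.Finite := hY.image2 _ hY
  have hCinv : ∀ c ∈ C, c⁻¹ ∈ C := by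
    rintro _ ⟨x, hx, y, hy, rfl⟩
    exact ⟨y, hy, x, hx, by simp only [IPLoop.mul_inv_rev, IPLoop.inv_inv]⟩
  have h1Y : (1 : G) ∈ Y := Or.inl rfl
  have : Finite Y := hY
  have : Finite C := hC
  have : Nonempty C := ⟨⟨_, Set.mem_image2_of_mem h1Y h1Y⟩⟩
  obtain ⟨n, ⟨u⟩⟩ := Finite.exists_equiv_fin Y
  obtain ⟨m, ⟨v⟩⟩ := Finite.exists_equiv_fin C
  have : NeZero n := ⟨by rintro rfl; exact (u ⟨1, h1Y⟩).elim0⟩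
  have : NeZero m := ⟨by rintro rfl; exact (v (Classical.arbitrary C)).elim0⟩
  let d : Fin n → Fin n → Fin m := fun x y =>
    v ⟨(u.symm x : G) * (u.symm y : G)⁻¹,
      Set.mem_image2_of_mem (u.symm x).2 (u.symm y).2⟩
  let ι : Fin m → Fin m := fun c => v ⟨(v.symm c : G)⁻¹, hCinv _ (v.symm c).2⟩
  have d_eq : ∀ x y z w, d x y = d z w ↔
      (u.symm x : G) * (u.symm y : G)⁻¹ = (u.symm z : G) * (u.symm w : G)⁻¹ := fun x y z w => by
    simp [d]
  let e := u ⟨1, h1Y⟩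
  have he : (u.symm e : G) = 1 := by simp [e]
  obtain ⟨L, hLinv, hLmul⟩ := exists_antiInverseLoop (d := d) (ι := ι)
    (fun c => by simp [ι, IPLoop.inv_inv])
    (fun x y => by simp [d, ι, IPLoop.mul_inv_rev, IPLoop.inv_inv])
    (fun x y z h => u.symm.injective <| Subtype.ext <| IPLoop.inv_injective <|
      IPLoop.mul_left_cancel ((d_eq _ _ _ _).1 h)) e
    (fun x => (d_eq _ _ _ _).2 (by rw [IPLoop.mul_inv, IPLoop.mul_inv]))
  let η : Y → Fin n × Fin m × Bool := fun x => (u x, 0, false)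
  have η_inj : Function.Injective η := fun x y h => u.injective (congrArg Prod.fst h)
  have hinv : ∀ x : Y, L.inv (η x) = η ⟨(x : G)⁻¹, hYinv _ x.2⟩ := fun x =>
    hLinv _ _ ((d_eq _ _ _ _).2 (by simp [he, IPLoop.one_inv, IPLoop.one_mul, IPLoop.mul_one]))
  have hmul : ∀ x y z : Y, (x : G) * y = z → L.mul (η x) (η y) = η z := fun x y z h => by
    have h' := hLmul (u x) (u ⟨(y : G)⁻¹, hYinv _ y.2⟩) (u z)
      ((d_eq _ _ _ _).2 (by simp [he, IPLoop.one_inv, IPLoop.inv_inv, IPLoop.mul_one, h]))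
    have hy : L.inv (η ⟨(y : G)⁻¹, hYinv _ y.2⟩) = η y := by
      rw [← hinv, L.inv_inv]
    rw [← hy]
    exact h'
  let φ : G → (Fin n × Fin m × Bool) × ZMod 3 := fun x =>
    if hx : x ∈ Y then (η ⟨x, hx⟩, 0) else 0
  have φ_eq : ∀ x (hx : x ∈ X), φ x = (η ⟨x, hXY x hx⟩, 0) := fun x hx => dif_pos (hXY x hx)
  refine ⟨_, L.coverIPLoop, inferInstance, φ, fun x hx y hy h => ?_, fun x hx y hy hxy => ?_⟩
  · rw [φ_eq x hx, φ_eq y hy] at h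
    exact congrArg Subtype.val (η_inj (congrArg Prod.fst h))
  · rw [φ_eq x hx, φ_eq y hy, φ_eq _ hxy]
    have hp := hmul ⟨x, hXY x hx⟩ ⟨y, hXY y hy⟩ ⟨_, hXY _ hxy⟩ rfl
    have hg : L.Good (η ⟨x, hXY x hx⟩) (η ⟨y, hXY y hy⟩) := by
      unfold AntiInverseLoop.Good
      rw [hp, hinv, hinv]
      exact ⟨hmul _ _ _ (IPLoop.mul_inv_cancel x y), hmul _ _ _ (IPLoop.ip_left x y)⟩
    rw [← hp]
    exact (L.coverMul_zero hg).symm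
end

section
/- Every group is locally embeddable into the class of finite IP loops: for every group G and every finite subset X ⊆ G, there exist a finite IP loop (H,*) and an injective map φ : X → H such that φ(x·y) = φ(x) * φ(y) for all x, y ∈ X with x·y ∈ X. -/
namespace LocalEmbedding

section Twist

variable {G K : Type*} [Group G] [Group K]

/-- The element by which `σ` fails to be multiplicative at `(x, y)`:
`σ x * defect σ x y * σ y = σ (x * y)`. -/
def defect (σ : G → K) (x y : G) : K := (σ x)⁻¹ * σ (x * y) * (σ y)⁻¹

/-- The pair `(p, q)` lies in a block `σ x ⟨u⟩ × ⟨u⟩ σ y`, where `x, y, x * y ∈ Ω` and `u` is the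
defect of `σ` at `(x, y)`. -/
def Covers (Ω : Set G) (σ : G → K) (p q u : K) : Prop :=
  ∃ x ∈ Ω, ∃ y ∈ Ω, x * y ∈ Ω ∧ u = defect σ x y ∧
    (∃ i : ℤ, p = σ x * u ^ i) ∧ ∃ j : ℤ, q = u ^ j * σ y

/-- An odd map `σ` from a symmetric set `Ω ∋ 1` whose blocks are pairwise disjoint, because the
points `x` and `y` of a block can be read off from its elements by means of `π`. -/
structure IsSeparated (Ω : Set G) (σ : G → K) (π : K → G) : Prop where
  one_mem : 1 ∈ Ω
  inv_mem : ∀ x ∈ Ω, x⁻¹ ∈ Ω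
  map_one : σ 1 = 1
  map_inv : ∀ x, σ x⁻¹ = (σ x)⁻¹
  proj_left : ∀ x ∈ Ω, ∀ y ∈ Ω, x * y ∈ Ω → ∀ i : ℤ, π (σ x * defect σ x y ^ i) = x
  proj_right : ∀ x ∈ Ω, ∀ y ∈ Ω, x * y ∈ Ω → ∀ i : ℤ, π (defect σ x y ^ i * σ y) = y

open Classical in
/-- The common defect of the blocks containing `(p, q)`, and `1` if there is none. -/
noncomputable def twist (Ω : Set G) (σ : G → K) (p q : K) : K :=
  if h : ∃ u, Covers Ω σ p q u then h.choose else 1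

/-- The group operation of `K`, shifted inside each block by the defect of the block. -/
noncomputable def twistedMul (Ω : Set G) (σ : G → K) (p q : K) : K := p * twist Ω σ p q * q

theorem twist_of_forall_not {Ω : Set G} {σ : G → K} {p q : K} (h : ∀ u, ¬ Covers Ω σ p q u) :
    twist Ω σ p q = 1 :=
  dif_neg fun ⟨u, hu⟩ => h u hu

namespace IsSeparated

variable {Ω : Set G} {σ : G → K} {π : K → G} (hσ : IsSeparated Ω σ π)
include hσ

theorem eq_defect_of_covers {p q u : K} (h : Covers Ω σ p q u) : u = defect σ (π p) (π q) := by
  obtain ⟨x, hx, y, hy, hxy, rfl, ⟨i, rfl⟩, j, rfl⟩ := h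
  rw [hσ.proj_left x hx y hy hxy, hσ.proj_right x hx y hy hxy]

theorem twist_of_covers {p q u : K} (h : Covers Ω σ p q u) : twist Ω σ p q = u := by
  have h' : ∃ u, Covers Ω σ p q u := ⟨u, h⟩
  rw [twist, dif_pos h', hσ.eq_defect_of_covers h'.choose_spec, ← hσ.eq_defect_of_covers h]

theorem defect_one_left (y : G) : defect σ 1 y = 1 := by
  simp [defect, hσ.map_one]

theorem defect_inv_inv (x y : G) : defect σ y⁻¹ x⁻¹ = (defect σ x y)⁻¹ := by
  simp only [defect, hσ.map_inv, ← mul_inv_rev x y]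
  group

theorem defect_inv_mul (x y : G) :
    defect σ x⁻¹ (x * y) = σ x * (defect σ x y)⁻¹ * (σ x)⁻¹ := by
  simp [defect, hσ.map_inv, mul_assoc]

theorem covers_inv {p q u : K} (h : Covers Ω σ p q u) : Covers Ω σ q⁻¹ p⁻¹ u⁻¹ := by
  obtain ⟨x, hx, y, hy, hxy, hu, ⟨i, rfl⟩, j, rfl⟩ := h
  refine ⟨y⁻¹, hσ.inv_mem y hy, x⁻¹, hσ.inv_mem x hx, ?_, ?_, ⟨j, ?_⟩, i, ?_⟩
  · simpa using hσ.inv_mem _ hxy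
  · rw [hσ.defect_inv_inv, hu]
  · simp [hσ.map_inv]
  · simp [hσ.map_inv]

theorem covers_inv_mul {p q u : K} (h : Covers Ω σ p q u) (k : ℤ) :
    Covers Ω σ p⁻¹ (p * u ^ k * q) (p * u⁻¹ * p⁻¹) := by
  obtain ⟨x, hx, y, hy, hxy, hu, ⟨i, rfl⟩, j, rfl⟩ := h
  have hconj : σ x * u ^ i * u⁻¹ * (σ x * u ^ i)⁻¹ = σ x * u⁻¹ * (σ x)⁻¹ := by group
  have hσxy : σ (x * y) = σ x * u * σ y := by rw [hu, defect]; group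
  rw [hconj]
  refine ⟨x⁻¹, hσ.inv_mem x hx, x * y, hxy, by simpa using hy, ?_, ⟨i, ?_⟩,
    1 - (i + k + j), ?_⟩
  · rw [hσ.defect_inv_mul, hu]
  · rw [hσ.map_inv, conj_zpow]; group
  · rw [hσxy, conj_zpow]; group

theorem twist_inv (p q : K) : twist Ω σ q⁻¹ p⁻¹ = (twist Ω σ p q)⁻¹ := by
  by_cases h : ∃ u, Covers Ω σ p q u
  · obtain ⟨u, hu⟩ := h
    rw [hσ.twist_of_covers hu, hσ.twist_of_covers (hσ.covers_inv hu)]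
  · push Not at h
    rw [twist_of_forall_not h, twist_of_forall_not, inv_one]
    exact fun u hu => h u⁻¹ (by simpa using hσ.covers_inv hu)

theorem twistedMul_inv_rev (p q : K) :
    (twistedMul Ω σ p q)⁻¹ = twistedMul Ω σ q⁻¹ p⁻¹ := by
  simp [twistedMul, hσ.twist_inv, mul_assoc]

theorem inv_twistedMul_cancel_left (p q : K) :
    twistedMul Ω σ p⁻¹ (twistedMul Ω σ p q) = q := by
  by_cases h : ∃ u, Covers Ω σ p q u
  · obtain ⟨u, hu⟩ := h
    have hu' := hσ.covers_inv_mul hu 1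
    rw [zpow_one] at hu'
    rw [twistedMul, twistedMul, hσ.twist_of_covers hu, hσ.twist_of_covers hu']
    group
  · push Not at h
    have h' : ∀ v, ¬ Covers Ω σ p⁻¹ (p * q) v := fun v hv =>
      h _ (by simpa using hσ.covers_inv_mul hv 0)
    simp [twistedMul, twist_of_forall_not h, twist_of_forall_not h']

theorem twistedMul_inv_cancel_right (p q : K) :
    twistedMul Ω σ (twistedMul Ω σ q p) p⁻¹ = q := by
  apply inv_injective
  rw [hσ.twistedMul_inv_rev, hσ.twistedMul_inv_rev q p]
  exact hσ.inv_twistedMul_cancel_left p⁻¹ q⁻¹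

theorem one_twistedMul (q : K) : twistedMul Ω σ 1 q = q := by
  suffices h : twist Ω σ 1 q = 1 by simp [twistedMul, h]
  by_cases h : ∃ u, Covers Ω σ 1 q u
  · obtain ⟨u, hu⟩ := h
    have hπ : π 1 = 1 := by
      simpa [hσ.map_one] using hσ.proj_left 1 hσ.one_mem 1 hσ.one_mem (by simpa using hσ.one_mem) 0
    rw [hσ.twist_of_covers hu, hσ.eq_defect_of_covers hu, hπ, hσ.defect_one_left]
  · push Not at h
    exact twist_of_forall_not h

theorem twistedMul_one (p : K) : twistedMul Ω σ p 1 = p := by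
  apply inv_injective
  rw [hσ.twistedMul_inv_rev, inv_one, hσ.one_twistedMul]

theorem twistedMul_map {x y : G} (hx : x ∈ Ω) (hy : y ∈ Ω) (hxy : x * y ∈ Ω) :
    twistedMul Ω σ (σ x) (σ y) = σ (x * y) := by
  have h : Covers Ω σ (σ x) (σ y) (defect σ x y) :=
    ⟨x, hx, y, hy, hxy, rfl, ⟨0, by simp⟩, 0, by simp⟩
  rw [twistedMul, hσ.twist_of_covers h, defect]
  group

theorem injOn : Set.InjOn σ Ω := by
  have h : ∀ x ∈ Ω, π (σ x) = x := fun x hx => by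
    simpa using hσ.proj_left x hx 1 hσ.one_mem (by simpa using hx) 0
  exact fun x hx y hy hxy => by rw [← h x hx, hxy, h y hy]

/-- `K` with the twisted multiplication is an IP loop. -/
@[reducible]
noncomputable def ipLoop : IPLoop K where
  mul := twistedMul Ω σ
  one := 1
  inv := fun p => p⁻¹
  one_mul := hσ.one_twistedMul
  mul_one := hσ.twistedMul_one
  existsUnique_left a b :=
    ⟨twistedMul Ω σ a⁻¹ b,
      by
        have h := hσ.inv_twistedMul_cancel_left a⁻¹ b
        rwa [inv_inv] at h,
      fun x (hx : twistedMul Ω σ a x = b) => by rw [← hx, hσ.inv_twistedMul_cancel_left]⟩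
  existsUnique_right a b :=
    ⟨twistedMul Ω σ b a⁻¹,
      by
        have h := hσ.twistedMul_inv_cancel_right a⁻¹ b
        rwa [inv_inv] at h,
      fun x (hx : twistedMul Ω σ x a = b) => by rw [← hx, hσ.twistedMul_inv_cancel_right]⟩
  mul_inv p := by
    have h := hσ.twistedMul_inv_cancel_right p 1
    rwa [hσ.one_twistedMul] at h
  inv_mul p := by
    have h := hσ.inv_twistedMul_cancel_left p 1
    rwa [hσ.twistedMul_one] at h
  ip_left := hσ.inv_twistedMul_cancel_left
  ip_right := hσ.twistedMul_inv_cancel_right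

end IsSeparated

theorem IsSeparated.congr {L : Type*} [Group L] {Ω : Set G} {σ : G → K} {π : K → G}
    (hσ : IsSeparated Ω σ π) (e : K ≃* L) :
    IsSeparated Ω (fun x => e (σ x)) (fun p => π (e.symm p)) where
  one_mem := hσ.one_mem
  inv_mem := hσ.inv_mem
  map_one := by simp [hσ.map_one]
  map_inv x := by simp [hσ.map_inv]
  proj_left x hx y hy hxy i := by
    simpa [defect] using hσ.proj_left x hx y hy hxy i
  proj_right x hx y hy hxy i := by
    simpa [defect] using hσ.proj_right x hx y hy hxy i

end Twist

section Dilation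

variable {G : Type*} [Group G] (Ω : Set G)

open Classical in
/-- On the lower copy of `Ω` this is left multiplication by `x` as far as it stays inside `Ω`, on
the upper copy it is left multiplication by `x⁻¹`; the remaining points change the copy. -/
noncomputable def dilationFun (x : G) : Ω × Bool → Ω × Bool
  | (w, false) => if h : x * w ∈ Ω then (⟨x * w, h⟩, false) else (w, true)
  | (w, true) => if h : x⁻¹ * w ∈ Ω then (⟨x⁻¹ * w, h⟩, true) else (w, false)

theorem dilationFun_inv_dilationFun (x : G) (w : Ω × Bool) :
    dilationFun Ω x⁻¹ (dilationFun Ω x w) = w := by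
  obtain ⟨w, b⟩ := w
  cases b
  · by_cases h : x * w ∈ Ω <;> simp [dilationFun, h]
  · by_cases h : x⁻¹ * w ∈ Ω <;> simp [dilationFun, h]

/-- The permutation of `Ω × Bool` extending the partial left multiplication by `x` on `Ω`. -/
noncomputable def dilation (x : G) : Equiv.Perm (Ω × Bool) where
  toFun := dilationFun Ω x
  invFun := dilationFun Ω x⁻¹
  left_inv := dilationFun_inv_dilationFun Ω x
  right_inv w := by simpa using dilationFun_inv_dilationFun Ω x⁻¹ w

theorem dilation_inv (x : G) : dilation Ω x⁻¹ = (dilation Ω x)⁻¹ :=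
  Equiv.ext fun _ => rfl

theorem dilation_one : dilation Ω 1 = 1 := by
  ext1 ⟨w, b⟩
  cases b <;> simp [dilation, dilationFun]

theorem dilation_apply {x w v : G} (hw : w ∈ Ω) (hv : v ∈ Ω) (h : x * w = v) :
    dilation Ω x (⟨w, hw⟩, false) = (⟨v, hv⟩, false) := by
  subst h
  simp [dilation, dilationFun, hv]

theorem dilation_inv_apply {x w v : G} (hw : w ∈ Ω) (hv : v ∈ Ω) (h : x⁻¹ * w = v) :
    (dilation Ω x)⁻¹ (⟨w, hw⟩, false) = (⟨v, hv⟩, false) := by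
  rw [← dilation_inv, dilation_apply Ω hw hv h]

theorem isSeparated_dilation (h1 : 1 ∈ Ω) (hinv : ∀ x ∈ Ω, x⁻¹ ∈ Ω) :
    IsSeparated Ω (dilation Ω) (fun p => ((p (⟨1, h1⟩, false)).1 : G)) where
  one_mem := h1
  inv_mem := hinv
  map_one := dilation_one Ω
  map_inv := dilation_inv Ω
  proj_left x hx y hy hxy i := by
    have hfix : Function.IsFixedPt (⇑(defect (dilation Ω) x y)) ((⟨1, h1⟩, false) : Ω × Bool) := by
      simp only [Function.IsFixedPt, defect, Equiv.Perm.mul_apply]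
      rw [dilation_inv_apply Ω h1 (hinv y hy) (mul_one _),
        dilation_apply Ω (hinv y hy) hx (by group), dilation_inv_apply Ω hx h1 (by group)]
    rw [Equiv.Perm.mul_apply, (hfix.perm_zpow i).eq, dilation_apply Ω h1 hx (mul_one x)]
  proj_right x hx y hy hxy i := by
    have hfix : Function.IsFixedPt (⇑(defect (dilation Ω) x y)) ((⟨y, hy⟩, false) : Ω × Bool) := by
      simp only [Function.IsFixedPt, defect, Equiv.Perm.mul_apply]
      rw [dilation_inv_apply Ω hy h1 (by group), dilation_apply Ω h1 hxy (mul_one _),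
        dilation_inv_apply Ω hxy hy (by group)]
    rw [Equiv.Perm.mul_apply, dilation_apply Ω h1 hy (mul_one y), (hfix.perm_zpow i).eq]

end Dilation

end LocalEmbedding

open LocalEmbedding

/-- Every group is locally embeddable into the class of finite IP loops. -/
theorem group_locallyEmbeddable_finite_ipLoops {G : Type*} [Group G]
    (X : Set G) (hXfin : X.Finite) :
    ∃ (H : Type) (iH : IPLoop H) (_ : Fintype H) (φ : G → H),
      Set.InjOn φ X ∧
      ∀ x ∈ X, ∀ y ∈ X, x * y ∈ X → φ (x * y) = iH.toMul.mul (φ x) (φ y) := by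
  let Ω : Set G := {1} ∪ (X ∪ X⁻¹)
  have hXΩ : X ⊆ Ω := fun x hx => Or.inr (Or.inl hx)
  have hinv : ∀ x ∈ Ω, x⁻¹ ∈ Ω := by
    rintro x (rfl | hx | hx)
    · exact Or.inl inv_one
    · exact Or.inr (Or.inr (by simpa using hx))
    · exact Or.inr (Or.inl hx)
  have : Finite Ω := ((Set.finite_singleton 1).union (hXfin.union hXfin.inv)).to_subtype
  obtain ⟨n, ⟨e⟩⟩ := Finite.exists_equiv_fin (Ω × Bool)
  have hσ := (isSeparated_dilation Ω (Or.inl rfl) hinv).congr e.permCongrHom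
  exact ⟨Equiv.Perm (Fin n), hσ.ipLoop, inferInstance, _, hσ.injOn.mono hXΩ,
    fun x hx y hy hxy => (hσ.twistedMul_map (hXΩ hx) (hXΩ hy) (hXΩ hxy)).symm⟩
end

section
/- For every finite partial IP loop (P,·) there exists a finite partial IP loop (Q,*) such that Q is an extension of P and 3 divides o₃(Q). -/
/-- A partial IP loop: a set `carrier` with a partial binary operation defined on
a domain `dom ⊆ carrier ×ˢ carrier` (the value of `mul` is only meaningful on `dom`),
with a unit, unique two-sided inverses, and the inverse property. -/
structure PartialIPLoop (α : Type*) where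
  carrier : Set α
  one : α
  dom : Set (α × α)
  mul : α → α → α
  inv : α → α
  one_mem : one ∈ carrier
  dom_subset : dom ⊆ carrier ×ˢ carrier
  mul_mem : ∀ x y, (x, y) ∈ dom → mul x y ∈ carrier
  one_mul_dom : ∀ x ∈ carrier, (one, x) ∈ dom
  mul_one_dom : ∀ x ∈ carrier, (x, one) ∈ dom
  one_mul : ∀ x ∈ carrier, mul one x = x
  mul_one : ∀ x ∈ carrier, mul x one = x
  inv_mem : ∀ x ∈ carrier, inv x ∈ carrier
  mul_inv_dom : ∀ x ∈ carrier, (x, inv x) ∈ dom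
  inv_mul_dom : ∀ x ∈ carrier, (inv x, x) ∈ dom
  mul_inv : ∀ x ∈ carrier, mul x (inv x) = one
  inv_mul : ∀ x ∈ carrier, mul (inv x) x = one
  inv_unique : ∀ x ∈ carrier, ∀ y ∈ carrier,
    (x, y) ∈ dom → (y, x) ∈ dom → mul x y = one → mul y x = one → y = inv x
  ip_left_dom : ∀ x y, (x, y) ∈ dom → (inv x, mul x y) ∈ dom
  ip_right_dom : ∀ x y, (x, y) ∈ dom → (mul x y, inv y) ∈ dom
  ip_left : ∀ x y, (x, y) ∈ dom → mul (inv x) (mul x y) = y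
  ip_right : ∀ x y, (x, y) ∈ dom → mul (mul x y) (inv y) = x

namespace PartialIPLoop

variable {α : Type*}

/-- The set of gaps `Γ(P) = (P × P) \ D(P)`. -/
def gaps (P : PartialIPLoop α) : Set (α × α) :=
  (P.carrier ×ˢ P.carrier) \ P.dom

/-- The set `O₂(P)` of elements of order two. -/
def O2 (P : PartialIPLoop α) : Set α :=
  {x ∈ P.carrier | x ≠ P.one ∧ (x, x) ∈ P.dom ∧ P.mul x x = P.one}

/-- The set `O₃(P)` of elements of order three. -/
def O3 (P : PartialIPLoop α) : Set α :=
  {x ∈ P.carrier | x ≠ P.one ∧ (x, x) ∈ P.dom ∧ (x, P.mul x x) ∈ P.dom ∧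
    P.mul x (P.mul x x) = P.one}

/-- `Q` is an extension of `P`: `P ⊆ Q`, `D(P) ⊆ D(Q)`, and the operations
agree on `D(P)`. -/
def Ext (P Q : PartialIPLoop α) : Prop :=
  P.carrier ⊆ Q.carrier ∧ P.dom ⊆ Q.dom ∧
    ∀ x y, (x, y) ∈ P.dom → P.mul x y = Q.mul x y

end PartialIPLoop

namespace PartialIPLoop

variable {α : Type*}

theorem inv_one (P : PartialIPLoop α) : P.inv P.one = P.one :=
  (P.inv_unique _ P.one_mem _ P.one_mem (P.one_mul_dom _ P.one_mem) (P.one_mul_dom _ P.one_mem)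
    (P.one_mul _ P.one_mem) (P.one_mul _ P.one_mem)).symm

/-- The multiplication of `P` extended to the free adjunction of a cyclic group `{1, u, v}`. -/
noncomputable def adjoinMul (P : PartialIPLoop α) (u v x y : α) : α :=
  open Classical in
  if x = u then (if y = u then v else if y = v then P.one else u)
  else if x = v then (if y = u then P.one else if y = v then u else v)
  else if y = u then u else if y = v then v else P.mul x y

/-- The inversion of `P` extended by exchanging `u` and `v`. -/
noncomputable def adjoinInv (P : PartialIPLoop α) (u v x : α) : α :=
  open Classical in if x = u then v else if x = v then u else P.inv x

/-- The domain of the multiplication after adjoining a cyclic group `{1, u, v}`. -/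
def adjoinDom (P : PartialIPLoop α) (u v : α) : Set (α × α) :=
  {p | p ∈ P.dom ∨ ((p.1 = u ∨ p.1 = v) ∧ (p.2 = u ∨ p.2 = v ∨ p.2 = P.one)) ∨
    (p.1 = P.one ∧ (p.2 = u ∨ p.2 = v))}

/-- The partial IP loop obtained from `P` by freely adjoining a cyclic group `{1, u, v}`
of order three. -/
noncomputable def adjoin (P : PartialIPLoop α) (u v : α) (hu : u ∉ P.carrier)
    (hv : v ∉ P.carrier) (huv : u ≠ v) : PartialIPLoop α := by
  have hdom : ∀ x y, (x, y) ∈ P.dom → x ∈ P.carrier ∧ y ∈ P.carrier :=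
    fun x y h => P.dom_subset h
  have hone := P.one_mem
  have hinv_one := P.inv_one
  have hinv := P.inv_mem
  have hmul := P.mul_mem
  refine
    { carrier := {x | x ∈ P.carrier ∨ x = u ∨ x = v}
      one := P.one
      dom := P.adjoinDom u v
      mul := P.adjoinMul u v
      inv := P.adjoinInv u v
      one_mem := Or.inl P.one_mem
      dom_subset := ?_
      mul_mem := ?_
      one_mul_dom := ?_
      mul_one_dom := ?_
      one_mul := ?_
      mul_one := ?_
      inv_mem := ?_
      mul_inv_dom := ?_
      inv_mul_dom := ?_
      mul_inv := ?_
      inv_mul := ?_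
      inv_unique := ?_
      ip_left_dom := ?_
      ip_right_dom := ?_
      ip_left := ?_
      ip_right := ?_ }
  · rintro ⟨x, y⟩
    simp only [adjoinDom, Set.mem_ofPred_eq, Set.mem_prod]
    grind
  · simp only [adjoinDom, adjoinMul, Set.mem_ofPred_eq]
    grind
  · have h := P.one_mul_dom
    simp only [adjoinDom, Set.mem_ofPred_eq]
    grind
  · have h := P.mul_one_dom
    simp only [adjoinDom, Set.mem_ofPred_eq]
    grind
  · have h := P.one_mul
    simp only [adjoinMul, Set.mem_ofPred_eq]
    grind
  · have h := P.mul_one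
    simp only [adjoinMul, Set.mem_ofPred_eq]
    grind
  · simp only [adjoinInv, Set.mem_ofPred_eq]
    grind
  · have h := P.mul_inv_dom
    simp only [adjoinDom, adjoinInv, Set.mem_ofPred_eq]
    grind
  · have h := P.inv_mul_dom
    simp only [adjoinDom, adjoinInv, Set.mem_ofPred_eq]
    grind
  · have h := P.mul_inv
    simp only [adjoinMul, adjoinInv, Set.mem_ofPred_eq]
    grind
  · have h := P.inv_mul
    simp only [adjoinMul, adjoinInv, Set.mem_ofPred_eq]
    grind
  · have h := P.inv_unique
    simp only [adjoinDom, adjoinMul, adjoinInv, Set.mem_ofPred_eq]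
    grind
  · have h := P.ip_left_dom
    simp only [adjoinDom, adjoinMul, adjoinInv, Set.mem_ofPred_eq]
    grind
  · have h := P.ip_right_dom
    simp only [adjoinDom, adjoinMul, adjoinInv, Set.mem_ofPred_eq]
    grind
  · have h := P.ip_left
    simp only [adjoinDom, adjoinMul, adjoinInv, Set.mem_ofPred_eq]
    grind
  · have h := P.ip_right
    simp only [adjoinDom, adjoinMul, adjoinInv, Set.mem_ofPred_eq]
    grind

theorem ext_adjoin (P : PartialIPLoop α) {u v : α} (hu : u ∉ P.carrier)
    (hv : v ∉ P.carrier) (huv : u ≠ v) : P.Ext (P.adjoin u v hu hv huv) := by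
  refine ⟨fun x hx => Or.inl hx, fun x hx => Or.inl hx, fun x y hxy => ?_⟩
  have hx : x ∈ P.carrier ∧ y ∈ P.carrier := P.dom_subset hxy
  simp only [adjoin, adjoinMul]
  grind

theorem O3_adjoin (P : PartialIPLoop α) {u v : α} (hu : u ∉ P.carrier)
    (hv : v ∉ P.carrier) (huv : u ≠ v) :
    (P.adjoin u v hu hv huv).O3 = insert u (insert v P.O3) := by
  have hdom : ∀ x y, (x, y) ∈ P.dom → x ∈ P.carrier ∧ y ∈ P.carrier :=
    fun x y h => P.dom_subset h
  have hone := P.one_mem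
  have hm := P.mul_mem
  ext x
  simp only [O3, adjoin, adjoinMul, adjoinDom, Set.mem_ofPred_eq, Set.mem_insert_iff]
  grind

theorem Ext.trans {P Q R : PartialIPLoop α} (h : P.Ext Q) (h' : Q.Ext R) : P.Ext R :=
  ⟨h.1.trans h'.1, h.2.1.trans h'.2.1,
    fun x y hxy => (h.2.2 x y hxy).trans (h'.2.2 x y (h.2.1 hxy))⟩

theorem exists_ext_ncard_O3_add_two [Infinite α] (P : PartialIPLoop α)
    (hP : P.carrier.Finite) :
    ∃ Q : PartialIPLoop α, Q.carrier.Finite ∧ P.Ext Q ∧ Q.O3.ncard = P.O3.ncard + 2 := by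
  obtain ⟨u, hu⟩ := hP.exists_notMem
  obtain ⟨v, hv⟩ := (hP.insert u).exists_notMem
  rw [Set.mem_insert_iff, not_or] at hv
  have hO3 : P.O3 ⊆ P.carrier := fun x hx => hx.1
  refine ⟨P.adjoin u v hu hv.2 (Ne.symm hv.1), ?_, P.ext_adjoin hu hv.2 _, ?_⟩
  · exact hP.union ((Set.finite_singleton v).insert u)
  · have hfin : P.O3.Finite := hP.subset hO3
    rw [O3_adjoin, Set.ncard_insert_of_notMem _ (hfin.insert v),
      Set.ncard_insert_of_notMem (fun h => hv.2 (hO3 h)) hfin]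
    rintro (h | h)
    · exact hv.1 h.symm
    · exact hu (hO3 h)

end PartialIPLoop

/-- For every finite partial IP loop `P` there exists a finite partial IP loop `Q`
extending `P` such that `3 ∣ o₃(Q)`. -/
theorem exists_extension_three_dvd_o3 {α : Type*} [Infinite α]
    (P : PartialIPLoop α) (hP : P.carrier.Finite) :
    ∃ Q : PartialIPLoop α, Q.carrier.Finite ∧ P.Ext Q ∧ 3 ∣ Q.O3.ncard := by
  obtain ⟨Q, hQ, hPQ, hcard⟩ := P.exists_ext_ncard_O3_add_two hP
  obtain ⟨R, hR, hQR, hcard'⟩ := Q.exists_ext_ncard_O3_add_two hQ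
  have h : 3 ∣ P.O3.ncard ∨ 3 ∣ Q.O3.ncard ∨ 3 ∣ R.O3.ncard := by omega
  rcases h with h | h | h
  · exact ⟨P, hP, ⟨subset_rfl, subset_rfl, fun _ _ _ => rfl⟩, h⟩
  · exact ⟨Q, hQ, hPQ, h⟩
  · exact ⟨R, hR, hPQ.trans hQR, h⟩
end

section
/- Let P be a finite partial IP loop with 3 | o₃(P). Then there exists a finite partial IP loop Q extending P such that: 3 | o₃(Q), #Q ≥ 10, #Q ≡ 4 (mod 6), and Γ(Q) ⊆ O₂(Q) × O₂(Q). -/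
namespace PartialIPLoop

variable {α : Type*}

/-- The relation `(x y) z = 1`, as a relation on the triples of elements of `P`. -/
def Triple (P : PartialIPLoop α) (x y z : α) : Prop :=
  (x, y) ∈ P.dom ∧ z ∈ P.carrier ∧ P.mul x y = P.inv z

theorem inv_inv (P : PartialIPLoop α) {x : α} (hx : x ∈ P.carrier) : P.inv (P.inv x) = x :=
  (P.inv_unique _ (P.inv_mem x hx) x hx (P.inv_mul_dom x hx) (P.mul_inv_dom x hx)
    (P.inv_mul x hx) (P.mul_inv x hx)).symm

theorem inv_injOn (P : PartialIPLoop α) {x y : α} (hx : x ∈ P.carrier) (hy : y ∈ P.carrier)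
    (h : P.inv x = P.inv y) : x = y := by
  rw [← P.inv_inv hx, h, P.inv_inv hy]

namespace Triple

variable {P : PartialIPLoop α} {x y z w : α}

theorem left_mem (h : P.Triple x y z) : x ∈ P.carrier := (P.dom_subset h.1).1

theorem mid_mem (h : P.Triple x y z) : y ∈ P.carrier := (P.dom_subset h.1).2

theorem right_mem (h : P.Triple x y z) : z ∈ P.carrier := h.2.1

theorem cyc (h : P.Triple x y z) : P.Triple y z x := by
  have h1 := P.ip_left_dom x y h.1
  have e1 := P.ip_left x y h.1
  have h2 := P.ip_right_dom _ _ h1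
  have e2 := P.ip_right _ _ h1
  rw [e1, h.2.2, P.inv_inv h.2.1] at h2 e2
  exact ⟨h2, h.left_mem, e2⟩

theorem rev (h : P.Triple x y z) : P.Triple (P.inv z) (P.inv y) (P.inv x) := by
  have h1 := P.ip_right_dom x y h.1
  have e1 := P.ip_right x y h.1
  rw [h.2.2] at h1 e1
  exact ⟨h1, P.inv_mem _ h.left_mem, by rw [e1, P.inv_inv h.left_mem]⟩

theorem unique (h : P.Triple x y z) (h' : P.Triple x y w) : z = w :=
  P.inv_injOn h.2.1 h'.2.1 (h.2.2.symm.trans h'.2.2)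

end Triple

theorem mem_dom_iff (P : PartialIPLoop α) {x y : α} : (x, y) ∈ P.dom ↔ ∃ z, P.Triple x y z :=
  ⟨fun h => ⟨P.inv (P.mul x y), h, P.inv_mem _ (P.mul_mem _ _ h),
    (P.inv_inv (P.mul_mem _ _ h)).symm⟩, fun ⟨_, h⟩ => h.1⟩

theorem triple_one (P : PartialIPLoop α) {x : α} (hx : x ∈ P.carrier) :
    P.Triple P.one x (P.inv x) :=
  ⟨P.one_mul_dom x hx, P.inv_mem x hx, by rw [P.one_mul x hx, P.inv_inv hx]⟩

theorem dom_rev (P : PartialIPLoop α) {x y : α} (h : (x, y) ∈ P.dom) :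
    (P.inv y, P.inv x) ∈ P.dom := by
  obtain ⟨z, hz⟩ := P.mem_dom_iff.1 h
  exact hz.rev.cyc.1

theorem dom_rev_iff (P : PartialIPLoop α) {x y : α} (hx : x ∈ P.carrier) (hy : y ∈ P.carrier) :
    (P.inv y, P.inv x) ∈ P.dom ↔ (x, y) ∈ P.dom := by
  refine ⟨fun h => ?_, P.dom_rev⟩
  simpa only [P.inv_inv hx, P.inv_inv hy] using P.dom_rev h

theorem mem_O2_iff (P : PartialIPLoop α) {x : α} :
    x ∈ P.O2 ↔ x ∈ P.carrier ∧ x ≠ P.one ∧ P.inv x = x := by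
  constructor
  · rintro ⟨hx, h1, hd, he⟩
    exact ⟨hx, h1, (P.inv_unique x hx x hx hd hd he he).symm⟩
  · rintro ⟨hx, h1, he⟩
    refine ⟨hx, h1, ?_, ?_⟩
    · simpa only [he] using P.mul_inv_dom x hx
    · simpa only [he] using P.mul_inv x hx

theorem mem_O3_iff (P : PartialIPLoop α) {x : α} :
    x ∈ P.O3 ↔ x ≠ P.one ∧ P.Triple x x x := by
  constructor
  · rintro ⟨hx, h1, hd, hd', he⟩
    have ht : P.Triple x (P.mul x x) P.one := ⟨hd', P.one_mem, by rw [he, P.inv_one]⟩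
    have h2 := ht.cyc.cyc.unique (P.triple_one hx)
    exact ⟨h1, hd, hx, h2⟩
  · rintro ⟨h1, h⟩
    have hx := h.left_mem
    refine ⟨hx, h1, h.1, ?_, ?_⟩
    · simpa only [h.2.2] using P.mul_inv_dom x hx
    · simpa only [h.2.2] using P.mul_inv x hx

open Classical in
/-- A relation with the symmetries of `(x y) z = 1` is the triple relation of a partial IP loop. -/
theorem exists_of_triples (C : Set α) (e : α) (i : α → α) (T : α → α → α → Prop)
    (he : e ∈ C) (hi : ∀ x ∈ C, i x ∈ C) (hii : ∀ x ∈ C, i (i x) = x) (hie : i e = e)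
    (hT : ∀ x y z, T x y z → x ∈ C) (hcyc : ∀ x y z, T x y z → T y z x)
    (hrev : ∀ x y z, T x y z → T (i z) (i y) (i x))
    (huniq : ∀ x y z w, T x y z → T x y w → z = w)
    (hone : ∀ x ∈ C, T e x (i x)) :
    ∃ Q : PartialIPLoop α, Q.carrier = C ∧ Q.one = e ∧ Q.inv = i ∧
      ∀ x y z, Q.Triple x y z ↔ T x y z := by
  let m : α → α → α := fun x y => if h : ∃ z, T x y z then i h.choose else e
  have hm : ∀ x y z, T x y z → m x y = i z := by
    intro x y z h
    have h' : ∃ z, T x y z := ⟨z, h⟩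
    simp only [m, dif_pos h']
    rw [huniq _ _ _ _ h'.choose_spec h]
  have hT3 : ∀ x y z, T x y z → z ∈ C := fun x y z h => hT _ _ _ (hcyc _ _ _ (hcyc _ _ _ h))
  have hinv : ∀ x ∈ C, T x (i x) e := fun x hx => hcyc _ _ _ (hone x hx)
  have hinv' : ∀ x ∈ C, T (i x) x e := fun x hx => by
    simpa only [hii x hx] using hinv (i x) (hi x hx)
  have hone' : ∀ x ∈ C, T x e (i x) := fun x hx => hcyc _ _ _ (hinv' x hx)
  have hleft : ∀ x y z, T x y z → T (i x) (i z) (i y) := fun x y z h =>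
    hcyc _ _ _ (hcyc _ _ _ (hrev _ _ _ h))
  let Q : PartialIPLoop α :=
    { carrier := C
      one := e
      dom := {p | ∃ z, T p.1 p.2 z}
      mul := m
      inv := i
      one_mem := he
      dom_subset := by
        rintro ⟨x, y⟩ ⟨z, h⟩
        exact ⟨hT _ _ _ h, hT _ _ _ (hcyc _ _ _ h)⟩
      mul_mem := by
        rintro x y ⟨z, h⟩
        rw [hm _ _ _ h]
        exact hi _ (hT3 _ _ _ h)
      one_mul_dom := fun x hx => ⟨_, hone x hx⟩
      mul_one_dom := fun x hx => ⟨_, hone' x hx⟩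
      one_mul := fun x hx => by rw [hm _ _ _ (hone x hx), hii x hx]
      mul_one := fun x hx => by rw [hm _ _ _ (hone' x hx), hii x hx]
      inv_mem := hi
      mul_inv_dom := fun x hx => ⟨_, hinv x hx⟩
      inv_mul_dom := fun x hx => ⟨_, hinv' x hx⟩
      mul_inv := fun x hx => by rw [hm _ _ _ (hinv x hx), hie]
      inv_mul := fun x hx => by rw [hm _ _ _ (hinv' x hx), hie]
      inv_unique := by
        rintro x hx y - ⟨z, h⟩ - h1 -
        rw [hm _ _ _ h] at h1
        have hz : z = e := by rw [← hii z (hT3 _ _ _ h), h1, hie]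
        subst hz
        exact huniq _ _ _ _ (hcyc _ _ _ (hcyc _ _ _ h)) (hone x hx)
      ip_left_dom := by
        rintro x y ⟨z, h⟩
        rw [hm _ _ _ h]
        exact ⟨_, hleft _ _ _ h⟩
      ip_right_dom := by
        rintro x y ⟨z, h⟩
        rw [hm _ _ _ h]
        exact ⟨_, hrev _ _ _ h⟩
      ip_left := by
        rintro x y ⟨z, h⟩
        rw [hm _ _ _ h, hm _ _ _ (hleft _ _ _ h), hii _ (hT _ _ _ (hcyc _ _ _ h))]
      ip_right := by
        rintro x y ⟨z, h⟩
        rw [hm _ _ _ h, hm _ _ _ (hrev _ _ _ h), hii _ (hT _ _ _ h)] }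
  refine ⟨Q, rfl, rfl, rfl, fun x y z => ⟨?_, fun h => ⟨⟨z, h⟩, hT3 _ _ _ h, hm _ _ _ h⟩⟩⟩
  rintro ⟨⟨w, h⟩, hz, hmul⟩
  have h1 : i w = i z := (hm _ _ _ h).symm.trans hmul
  rwa [← hii z hz, ← h1, hii w (hT3 _ _ _ h)]

theorem ext_of_triple {P Q : PartialIPLoop α} (hC : P.carrier ⊆ Q.carrier)
    (hi : ∀ x ∈ P.carrier, Q.inv x = P.inv x)
    (hT : ∀ x y z, P.Triple x y z → Q.Triple x y z) : P.Ext Q := by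
  have key : ∀ x y, (x, y) ∈ P.dom → (x, y) ∈ Q.dom ∧ P.mul x y = Q.mul x y := by
    intro x y h
    obtain ⟨z, hz⟩ := P.mem_dom_iff.1 h
    have hz' := hT _ _ _ hz
    exact ⟨hz'.1, by rw [hz.2.2, hz'.2.2, hi z hz.2.1]⟩
  exact ⟨hC, fun p hp => (key p.1 p.2 hp).1, fun x y h => (key x y h).2⟩

open Classical in
/-- Adjoining a set `N` of involutions, with no products beyond the forced ones. -/
theorem exists_add_involutions (P : PartialIPLoop α) (N : Set α)
    (hN : ∀ n ∈ N, n ∉ P.carrier) :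
    ∃ Q : PartialIPLoop α, Q.carrier = P.carrier ∪ N ∧
      (∀ x ∈ P.carrier, Q.inv x = P.inv x) ∧ (∀ n ∈ N, Q.inv n = n) ∧ P.Ext Q ∧
      Q.O3 = P.O3 ∧
      ∀ x y, (x, y) ∈ Q.dom ↔ (x, y) ∈ P.dom ∨
        ∃ n ∈ N, x = P.one ∧ y = n ∨ x = n ∧ y = n ∨ x = n ∧ y = P.one := by
  have hPN : ∀ x ∈ P.carrier, x ∉ N := fun x hx hx' => hN x hx' hx
  let i : α → α := fun x => if x ∈ N then x else P.inv x
  have iN : ∀ n ∈ N, i n = n := fun n hn => if_pos hn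
  have iP : ∀ x ∈ P.carrier, i x = P.inv x := fun x hx => if_neg (hPN x hx)
  have i1 : i P.one = P.one := by rw [iP _ P.one_mem, P.inv_one]
  obtain ⟨Q, hC, he, hi, hT⟩ := exists_of_triples (P.carrier ∪ N) P.one i
    (fun x y z => P.Triple x y z ∨ ∃ n ∈ N, x = P.one ∧ y = n ∧ z = n ∨
      x = n ∧ y = n ∧ z = P.one ∨ x = n ∧ y = P.one ∧ z = n)
    (Or.inl P.one_mem)
    (by
      rintro x (hx | hx)
      · rw [iP x hx]; exact Or.inl (P.inv_mem x hx)
      · rw [iN x hx]; exact Or.inr hx)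
    (by
      rintro x (hx | hx)
      · rw [iP x hx, iP _ (P.inv_mem x hx), P.inv_inv hx]
      · rw [iN x hx, iN x hx])
    i1
    (by
      rintro x y z (h | ⟨n, hn, ⟨rfl, -, -⟩ | ⟨rfl, -, -⟩ | ⟨rfl, -, -⟩⟩)
      · exact Or.inl h.left_mem
      · exact Or.inl P.one_mem
      · exact Or.inr hn
      · exact Or.inr hn)
    (by
      rintro x y z (h | ⟨n, hn, h⟩)
      · exact Or.inl h.cyc
      · exact Or.inr ⟨n, hn, by tauto⟩)
    (by
      rintro x y z (h | ⟨n, hn, ⟨rfl, rfl, rfl⟩ | ⟨rfl, rfl, rfl⟩ | ⟨rfl, rfl, rfl⟩⟩)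
      · rw [iP _ h.left_mem, iP _ h.mid_mem, iP _ h.right_mem]; exact Or.inl h.rev
      all_goals rw [i1, iN _ hn]; exact Or.inr ⟨_, hn, by tauto⟩)
    (by
      rintro x y z w (h | ⟨n, hn, h⟩) (h' | ⟨n', hn', h'⟩)
      · exact h.unique h'
      · have := hPN _ h.left_mem
        have := hPN _ h.mid_mem
        grind
      · have := hPN _ h'.left_mem
        have := hPN _ h'.mid_mem
        grind
      · grind)
    (by
      rintro x (hx | hx)
      · rw [iP x hx]; exact Or.inl (P.triple_one hx)
      · rw [iN x hx]; exact Or.inr ⟨x, hx, by tauto⟩)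
  refine ⟨Q, hC, ?_, ?_, ?_, ?_, ?_⟩
  · rw [hi]; exact iP
  · rw [hi]; exact iN
  · refine ext_of_triple (by rw [hC]; exact Set.subset_union_left) (by rw [hi]; exact iP)
      fun x y z h => (hT _ _ _).2 (Or.inl h)
  · ext x
    rw [mem_O3_iff, mem_O3_iff, he, hT]
    grind
  · intro x y
    rw [mem_dom_iff, mem_dom_iff]
    simp only [hT]
    constructor
    · rintro ⟨z, h | ⟨n, hn, h⟩⟩
      · exact Or.inl ⟨z, h⟩
      · exact Or.inr ⟨n, hn, by tauto⟩
    · rintro (⟨z, h⟩ | ⟨n, hn, h | h | h⟩)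
      · exact ⟨z, Or.inl h⟩
      · exact ⟨n, Or.inr ⟨n, hn, by tauto⟩⟩
      · exact ⟨P.one, Or.inr ⟨n, hn, by tauto⟩⟩
      · exact ⟨n, Or.inr ⟨n, hn, by tauto⟩⟩

/-- Filling gaps of `P` by the products `u v = w⁻¹`, `v w = u⁻¹`, `w u = v⁻¹` for the triples
`(u, v, w)` of a relation `R`. -/
theorem exists_add_triples (P : PartialIPLoop α) (U V : Set α) (hUV : ∀ x ∈ U, x ∉ V)
    (R : α → α → α → Prop) (hmem : ∀ u v w, R u v w → u ∈ U ∧ v ∈ V ∧ w ∈ V)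
    (hgap : ∀ u v w, R u v w → (u, v) ∈ P.gaps ∧ (v, w) ∈ P.gaps)
    (hrev : ∀ u v w, R u v w → R (P.inv u) (P.inv w) (P.inv v))
    (huniq : ∀ u v w w', R u v w → R u v w' → w = w')
    (huniq' : ∀ u u' v w, R u v w → R u' v w → u = u') :
    ∃ Q : PartialIPLoop α, Q.carrier = P.carrier ∧ Q.inv = P.inv ∧ P.Ext Q ∧
      Q.O3 = P.O3 ∧
      ∀ u v w, R u v w → (u, v) ∈ Q.dom ∧ (v, w) ∈ Q.dom := by
  have mem : ∀ u v w, R u v w → u ∈ P.carrier ∧ v ∈ P.carrier ∧ w ∈ P.carrier := fun u v w h =>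
    ⟨(hgap _ _ _ h).1.1.1, (hgap _ _ _ h).1.1.2, (hgap _ _ _ h).2.1.2⟩
  have hgap' : ∀ u v w, R u v w → (w, u) ∉ P.dom := fun u v w h hd =>
    (hgap _ _ _ (hrev _ _ _ h)).1.2 (P.dom_rev hd)
  have huniq'' : ∀ u v v' w, R u v w → R u v' w → v = v' := fun u v v' w h h' =>
    P.inv_injOn (mem _ _ _ h).2.1 (mem _ _ _ h').2.1
      (huniq _ _ _ _ (hrev _ _ _ h) (hrev _ _ _ h'))
  have hdom : ∀ x y z, R x y z ∨ R y z x ∨ R z x y → (x, y) ∉ P.dom := by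
    rintro x y z (h | h | h)
    · exact (hgap _ _ _ h).1.2
    · exact hgap' _ _ _ h
    · exact (hgap _ _ _ h).2.2
  obtain ⟨Q, hC, he, hi, hT⟩ := exists_of_triples P.carrier P.one P.inv
    (fun x y z => P.Triple x y z ∨ R x y z ∨ R y z x ∨ R z x y)
    P.one_mem P.inv_mem (fun x hx => P.inv_inv hx) P.inv_one
    (by
      rintro x y z (h | h | h | h)
      · exact h.left_mem
      · exact (mem _ _ _ h).1
      · exact (mem _ _ _ h).2.2
      · exact (mem _ _ _ h).2.1)
    (by
      rintro x y z (h | h)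
      · exact Or.inl h.cyc
      · exact Or.inr (by tauto))
    (by
      rintro x y z (h | h | h | h)
      · exact Or.inl h.rev
      · exact Or.inr (Or.inr (Or.inr (hrev _ _ _ h)))
      · exact Or.inr (Or.inr (Or.inl (hrev _ _ _ h)))
      · exact Or.inr (Or.inl (hrev _ _ _ h)))
    (by
      rintro x y z w (h | h) (h' | h')
      · exact h.unique h'
      · exact absurd h.1 (hdom _ _ _ h')
      · exact absurd h'.1 (hdom _ _ _ h)
      · grind)
    (fun x hx => Or.inl (P.triple_one hx))
  refine ⟨Q, hC, hi, ?_, ?_, ?_⟩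
  · exact ext_of_triple hC.ge (fun x _ => by rw [hi]) fun x y z h => (hT _ _ _).2 (Or.inl h)
  · ext x
    rw [mem_O3_iff, mem_O3_iff, he, hT]
    grind
  · intro u v w h
    exact ⟨((hT u v w).2 (by tauto)).1, ((hT v w u).2 (by tauto)).1⟩

theorem exists_embedding_avoiding [Infinite α] (β : Type*) [Finite β] {F : Set α}
    (hF : F.Finite) : ∃ f : β → α, Function.Injective f ∧ ∀ b, f b ∉ F := by
  have := hF.infinite_compl.to_subtype
  obtain ⟨g, hg⟩ := exists_injective_nat β
  refine ⟨fun b => Infinite.natEmbedding (Fᶜ : Set α) (g b), fun b b' h => ?_, fun b => ?_⟩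
  · exact hg ((Infinite.natEmbedding _).injective (Subtype.ext h))
  · exact (Infinite.natEmbedding (Fᶜ : Set α) (g b)).2

/-- The gaps between elements that are not of order two can be filled by fresh involutions. -/
theorem exists_fill_non_involutions [Infinite α] (P : PartialIPLoop α) (hP : P.carrier.Finite) :
    ∃ Q : PartialIPLoop α, Q.carrier.Finite ∧ P.Ext Q ∧ Q.O3 = P.O3 ∧
      ∀ x y, (x, y) ∈ Q.gaps → Q.inv x ≠ x → Q.inv y = y := by
  let B : Set (α × α) := {p | p ∈ P.gaps ∧ P.inv p.1 ≠ p.1 ∧ P.inv p.2 ≠ p.2}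
  have hB : B.Finite := (hP.prod hP).subset fun p hp => hp.1.1
  let K : α × α → Sym2 (α × α) := fun p => s(p, (P.inv p.2, P.inv p.1))
  have hKB : (K '' B).Finite := hB.image K
  have := hKB.to_subtype
  obtain ⟨f, hf, hfP⟩ := exists_embedding_avoiding (K '' B) hP
  let R : α → α → α → Prop := fun u v w => ∃ h : (v, w) ∈ B, u = f ⟨K (v, w), _, h, rfl⟩
  obtain ⟨P₁, hC, hi, hiN, hext, hO3, hd⟩ := P.exists_add_involutions (Set.range f)
    (by rintro _ ⟨b, rfl⟩; exact hfP b)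
  have hne1 : ∀ x, P.inv x ≠ x → x ≠ P.one := by
    rintro x h rfl
    exact h P.inv_one
  have hnotR : ∀ x ∈ P.carrier, x ∉ Set.range f := by
    rintro _ hx ⟨b, rfl⟩
    exact hfP b hx
  obtain ⟨Q, hC', hi', hext', hO3', hd'⟩ := P₁.exists_add_triples (Set.range f)
    P.carrier (by rintro _ ⟨b, rfl⟩; exact hfP b) R
    (by
      rintro u v w ⟨h, rfl⟩
      exact ⟨⟨_, rfl⟩, h.1.1⟩)
    (by
      rintro u v w ⟨h, rfl⟩
      have hv := hnotR v h.1.1.1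
      have hv1 := hne1 v h.2.1
      have hw := hnotR w h.1.1.2
      refine ⟨⟨⟨?_, ?_⟩, ?_⟩, ⟨⟨?_, ?_⟩, ?_⟩⟩
      · rw [hC]; exact Or.inr ⟨_, rfl⟩
      · rw [hC]; exact Or.inl h.1.1.1
      · rw [hd]
        rintro (h' | ⟨n, hn, h'⟩)
        · exact hfP _ (P.dom_subset h').1
        · grind
      · rw [hC]; exact Or.inl h.1.1.1
      · rw [hC]; exact Or.inl h.1.1.2
      · rw [hd]
        rintro (h' | ⟨n, hn, h'⟩)
        · exact h.1.2 h'
        · grind)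
    (by
      rintro u v w ⟨h, rfl⟩
      have hv : v ∈ P.carrier := h.1.1.1
      have hw : w ∈ P.carrier := h.1.1.2
      rw [hiN _ ⟨_, rfl⟩, hi v hv, hi w hw]
      refine ⟨⟨⟨⟨P.inv_mem _ hw, P.inv_mem _ hv⟩, ?_⟩, ?_, ?_⟩, ?_⟩
      · rw [P.dom_rev_iff hv hw]; exact h.1.2
      · rw [P.inv_inv hw]; exact h.2.2.symm
      · rw [P.inv_inv hv]; exact h.2.1.symm
      · congr 2
        simp only [K, P.inv_inv hv, P.inv_inv hw]
        exact Sym2.eq_swap)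
    (by
      rintro u v w w' ⟨h, rfl⟩ ⟨h', hu⟩
      have hK : K (v, w) = K (v, w') := congrArg Subtype.val (hf hu)
      rcases Sym2.eq_iff.1 hK with ⟨h1, -⟩ | ⟨h1, -⟩
      · exact (Prod.ext_iff.1 h1).2
      · have h2 : v = P.inv w' := (Prod.ext_iff.1 h1).1
        refine absurd ?_ h'.1.2
        rw [h2]
        exact P.inv_mul_dom _ h'.1.1.2)
    (by
      rintro u u' v w ⟨h, rfl⟩ ⟨h', rfl⟩
      rfl)
  refine ⟨Q, ?_, hext.trans hext', hO3'.trans hO3, ?_⟩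
  · rw [hC', hC]
    exact hP.union (Set.finite_range f)
  · rintro x y ⟨⟨hx, hy⟩, hxy⟩ hix
    by_contra hiy
    rw [hi'] at hix hiy
    have hmem : ∀ z ∈ Q.carrier, P₁.inv z ≠ z → z ∈ P.carrier := by
      intro z hz hiz
      rw [hC', hC] at hz
      exact hz.resolve_right fun h => hiz (hiN z h)
    have hx' := hmem x hx hix
    have hy' := hmem y hy hiy
    rw [hi x hx'] at hix
    rw [hi y hy'] at hiy
    have hB : (x, y) ∈ B := ⟨⟨⟨hx', hy'⟩, fun h => hxy (hext'.2.1 (hext.2.1 h))⟩, hix, hiy⟩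
    exact hxy (hd' _ x y ⟨hB, rfl⟩).2

theorem ncard_not_dom_inv (P : PartialIPLoop α) (hP : P.carrier.Finite) {a : α}
    (ha : a ∈ P.carrier) :
    {n ∈ P.carrier | (P.inv a, n) ∉ P.dom}.ncard = {n ∈ P.carrier | (a, n) ∉ P.dom}.ncard := by
  have key : ∀ b ∈ P.carrier, {n ∈ P.carrier | (b, n) ∉ P.dom} =
      P.carrier \ {n | (b, n) ∈ P.dom} := fun b _ => rfl
  have hsub : ∀ b, {n | (b, n) ∈ P.dom} ⊆ P.carrier := fun b n hn => (P.dom_subset hn).2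
  rw [key a ha, key _ (P.inv_mem a ha), Set.ncard_sdiff (hsub _) (hP.subset (hsub _)),
    Set.ncard_sdiff (hsub _) (hP.subset (hsub _))]
  congr 1
  symm
  refine Set.ncard_congr (fun n _ => P.mul a n) (fun n hn => P.ip_left_dom a n hn) ?_ ?_
  · intro n m hn hm h
    rw [← P.ip_left a n hn, ← P.ip_left a m hm, h]
  · intro n hn
    refine ⟨P.mul (P.inv a) n, ?_, ?_⟩
    · simpa only [P.inv_inv ha, Set.mem_ofPred_eq] using P.ip_left_dom (P.inv a) n hn
    · simpa only [P.inv_inv ha] using P.ip_left (P.inv a) n hn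

theorem exists_enumeration {S : Set α} (hS : S.Finite) (d : α) :
    ∃ s : ℕ → α, Set.BijOn s (Set.Iio S.ncard) S := by
  have := hS.to_subtype
  let e : S ≃ Fin S.ncard := Finite.equivFinOfCardEq rfl
  refine ⟨fun k => if h : k < S.ncard then e.symm ⟨k, h⟩ else d, ?_, ?_, ?_⟩
  · intro k hk
    simp only [Set.mem_Iio] at hk
    simp [hk]
  · intro k hk l hl h
    simp only [Set.mem_Iio] at hk hl
    simpa [hk, hl, Subtype.val_inj] using h
  · intro x hx
    refine ⟨e ⟨x, hx⟩, (e ⟨x, hx⟩).2, ?_⟩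
    simp

open Classical in
/-- If each gap involves an involution, then all gaps outside `O₂ × O₂` can be filled with the
help of a fresh set of involutions `(C → ℤ/7) × Fin r` on which `a` acts by a translation, altered
at as many places as there are gaps `(a, n)`. -/
theorem exists_fill_of_gaps [Infinite α] (P : PartialIPLoop α) (hP : P.carrier.Finite)
    (hgaps : ∀ x y, (x, y) ∈ P.gaps → P.inv x ≠ x → P.inv y = y) :
    ∃ Q : PartialIPLoop α, Q.carrier.Finite ∧ P.Ext Q ∧ Q.O3 = P.O3 ∧
      10 ≤ Q.carrier.ncard ∧ Q.carrier.ncard % 6 = 4 ∧ Q.gaps ⊆ Q.O2 ×ˢ Q.O2 := by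
  let C := P.carrier
  let r := 11 * C.ncard + 16
  have : Finite C := hP.to_subtype
  let S : α → Set α := fun a => {n ∈ C | (a, n) ∉ P.dom}
  let g : α → ℕ := fun a => (S a).ncard
  have hSfin : ∀ a, (S a).Finite := fun a => hP.subset fun n hn => hn.1
  have hg : ∀ a ∈ C, g (P.inv a) = g a := fun a ha => P.ncard_not_dom_inv hP ha
  have hgr : ∀ a, g a ≤ r := fun a =>
    (Set.ncard_le_ncard (fun n hn => hn.1) hP).trans (show C.ncard ≤ 11 * C.ncard + 16 by omega)
  choose s hs using fun a => exists_enumeration (hSfin a) P.one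
  have hsC : ∀ a k, k < g a → s a k ∈ S a := fun a k hk => (hs a).mapsTo hk
  obtain ⟨f, hf, hfC⟩ := exists_embedding_avoiding ((C → ZMod 7) × Fin r) hP
  have hfs : ∀ p a k, k < g a → f p ≠ s a k := fun p a k hk h => hfC p (h ▸ (hsC a k hk).1)
  let c : α → C → ZMod 7 := fun a x => if x.1 = a then 1 else 0
  have hc : ∀ a ∈ C, ∀ b, c a = c b → a = b := by
    intro a ha b h
    have := congrFun h ⟨a, ha⟩
    simp only [c, if_true] at this
    by_contra hab
    rw [if_neg hab] at this
    exact absurd this (by decide)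
  let t : α → C → ZMod 7 := fun a => c (P.inv a) - c a
  have ht : ∀ a ∈ C, P.inv a ≠ a → ∀ b, t a = t b → a = b := by
    intro a ha hia b h
    have := congrFun h ⟨a, ha⟩
    simp only [t, c, Pi.sub_apply, if_true, if_neg hia.symm] at this
    by_contra hab
    rw [if_neg hab] at this
    split_ifs at this
    · exact absurd this (by decide)
    · exact absurd this (by decide)
  have htinv : ∀ a ∈ C, t (P.inv a) = - t a := by
    intro a ha
    simp only [t, P.inv_inv ha, neg_sub]
  have hct : ∀ a, c a + t a = c (P.inv a) := fun a => by simp only [t]; abel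
  let A : Set α := {a ∈ C | P.inv a ≠ a}
  have hAinv : ∀ a ∈ A, P.inv a ∈ A := fun a ha =>
    ⟨P.inv_mem a ha.1, by rw [P.inv_inv ha.1]; exact ha.2.symm⟩
  have hA1 : ∀ a ∈ A, a ≠ P.one := by
    rintro a ha rfl
    exact ha.2 P.inv_one
  have hSI : ∀ a ∈ A, ∀ n ∈ S a, P.inv n = n := fun a ha n hn =>
    hgaps a n ⟨⟨ha.1, hn.1⟩, hn.2⟩ ha.2
  have hS1 : ∀ a ∈ A, ∀ n ∈ S a, n ≠ P.one := by
    rintro a ha n hn rfl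
    exact hn.2 (P.mul_one_dom a ha.1)
  let R : α → α → α → Prop := fun a n m => a ∈ A ∧
    ((∃ p, (∀ k : Fin r, k.1 < g a → p ≠ (c a, k)) ∧ n = f p ∧ m = f (p.1 + t a, p.2)) ∨
      (∃ k : Fin r, k.1 < g a ∧ n = s a k ∧ m = f (c (P.inv a), k)) ∨
      (∃ k : Fin r, k.1 < g a ∧ n = f (c a, k) ∧ m = s (P.inv a) k))
  have hRrev : ∀ a n m, R a n m → R (P.inv a) m n := by
    rintro a n m ⟨ha, h⟩
    refine ⟨hAinv a ha, ?_⟩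
    rw [hg a ha.1, P.inv_inv ha.1, htinv a ha.1]
    rcases h with ⟨p, hp, rfl, rfl⟩ | ⟨k, hk, rfl, rfl⟩ | ⟨k, hk, rfl, rfl⟩
    · refine Or.inl ⟨_, fun k hk h => hp k hk ?_, rfl, ?_⟩
      · rw [Prod.ext_iff] at h ⊢
        refine ⟨?_, h.2⟩
        have := h.1
        simp only [← hct] at this
        exact add_right_cancel this
      · simp
    · exact Or.inr (Or.inr ⟨k, hk, rfl, rfl⟩)
    · exact Or.inr (Or.inl ⟨k, hk, rfl, rfl⟩)
  obtain ⟨P₁, hC, hi, hiN, hext, hO3, hd⟩ := P.exists_add_involutions (Set.range f)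
    (by rintro _ ⟨b, rfl⟩; exact hfC b)
  have hf1 : ∀ p, f p ≠ P.one := fun p h => hfC p (h ▸ P.one_mem)
  have hfmem : ∀ p, f p ∈ P₁.carrier := fun p => hC ▸ Or.inr ⟨p, rfl⟩
  have hCmem : ∀ x ∈ C, x ∈ P₁.carrier := fun x hx => hC ▸ Or.inl hx
  have hgapC : ∀ x ∈ C, ∀ y ∈ C, (x, y) ∉ P.dom → (x, y) ∈ P₁.gaps := by
    refine fun x hx y hy h => ⟨⟨hCmem x hx, hCmem y hy⟩, ?_⟩
    rw [hd]
    rintro (h' | ⟨_, ⟨p, rfl⟩, h'⟩)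
    · exact h h'
    · have := hfC p
      grind
  have hgapl : ∀ x ∈ C, x ≠ P.one → ∀ p, (x, f p) ∈ P₁.gaps := by
    refine fun x hx h1 p => ⟨⟨hCmem x hx, hfmem p⟩, ?_⟩
    rw [hd]
    rintro (h' | ⟨_, ⟨q, rfl⟩, h'⟩)
    · exact hfC p (P.dom_subset h').2
    · have := hfC q
      have := hf1 p
      grind
  have hgapr : ∀ x ∈ C, x ≠ P.one → ∀ p, (f p, x) ∈ P₁.gaps := by
    refine fun x hx h1 p => ⟨⟨hfmem p, hCmem x hx⟩, ?_⟩
    rw [hd]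
    rintro (h' | ⟨_, ⟨q, rfl⟩, h'⟩)
    · exact hfC p (P.dom_subset h').1
    · have := hfC q
      grind
  have hgapff : ∀ p q, p ≠ q → (f p, f q) ∈ P₁.gaps := by
    refine fun p q hpq => ⟨⟨hfmem p, hfmem q⟩, ?_⟩
    rw [hd]
    rintro (h' | ⟨_, ⟨q', rfl⟩, h'⟩)
    · exact hfC p (P.dom_subset h').1
    · have := hf1 p
      have := hf1 q
      have : f p ≠ f q := fun h => hpq (hf h)
      grind
  have hRI : ∀ a n m, R a n m → n ∈ {x ∈ P₁.carrier | P₁.inv x = x} := by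
    rintro a n m ⟨ha, ⟨p, hp, rfl, rfl⟩ | ⟨k, hk, rfl, rfl⟩ | ⟨k, hk, rfl, rfl⟩⟩
    · exact ⟨hfmem p, hiN _ ⟨p, rfl⟩⟩
    · have h := hsC a k hk
      exact ⟨hCmem _ h.1, (hi _ h.1).trans (hSI a ha _ h)⟩
    · exact ⟨hfmem _, hiN _ ⟨_, rfl⟩⟩
  obtain ⟨Q, hC', hi', hext', hO3', hd'⟩ := P₁.exists_add_triples A
    {x ∈ P₁.carrier | P₁.inv x = x}
    (fun a ha h => ha.2 ((hi a ha.1).symm.trans h.2)) R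
    (fun a n m h => ⟨h.1, hRI a n m h, hRI _ _ _ (hRrev a n m h)⟩)
    (by
      rintro a n m ⟨ha, ⟨p, hp, rfl, rfl⟩ | ⟨k, hk, rfl, rfl⟩ | ⟨k, hk, rfl, rfl⟩⟩
      · refine ⟨hgapl a ha.1 (hA1 a ha) p, hgapff _ _ fun h => ?_⟩
        have h0 : t a = 0 := by
          have := (Prod.ext_iff.1 h).1
          simpa using this
        exact ha.2 (hc _ (P.inv_mem a ha.1) _ (sub_eq_zero.1 h0))
      · have h := hsC a k hk
        exact ⟨hgapC a ha.1 _ h.1 h.2, hgapl _ h.1 (hS1 a ha _ h) _⟩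
      · have h := hsC (P.inv a) k (by rwa [hg a ha.1])
        exact ⟨hgapl a ha.1 (hA1 a ha) _, hgapr _ h.1 (hS1 _ (hAinv a ha) _ h) _⟩)
    (by
      intro a n m h
      have h' := hRrev a n m h
      rwa [hi a h.1.1, (hRI _ _ _ h).2, (hRI _ _ _ h').2])
    (by
      rintro a n m m' ⟨ha, h⟩ ⟨-, h'⟩
      rcases h with ⟨p, hp, rfl, rfl⟩ | ⟨k, hk, rfl, rfl⟩ | ⟨k, hk, rfl, rfl⟩ <;>
        rcases h' with ⟨q, hq, h, rfl⟩ | ⟨l, hl, h, rfl⟩ | ⟨l, hl, h, rfl⟩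
      · rw [hf h]
      · exact absurd h (hfs _ _ _ hl)
      · exact absurd (hf h) (hp l hl)
      · exact absurd h.symm (hfs _ _ _ hk)
      · rw [Fin.ext ((hs a).injOn hk hl h)]
      · exact absurd h.symm (hfs _ _ _ hk)
      · exact absurd (hf h).symm (hq k hk)
      · exact absurd h (hfs _ _ _ hl)
      · obtain rfl : k = l := (Prod.ext_iff.1 (hf h)).2
        rfl)
    (by
      rintro a b n m ⟨ha, h⟩ ⟨hb, h'⟩
      have hk' : ∀ a ∈ A, ∀ k, k < g a → k < g (P.inv a) := fun a ha k hk => by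
        rwa [hg a ha.1]
      rcases h with ⟨p, hp, rfl, rfl⟩ | ⟨k, hk, rfl, rfl⟩ | ⟨k, hk, rfl, rfl⟩ <;>
        rcases h' with ⟨q, hq, h, h'⟩ | ⟨l, hl, h, h'⟩ | ⟨l, hl, h, h'⟩
      · obtain rfl := hf h
        exact ht a ha.1 ha.2 b (add_left_cancel (Prod.ext_iff.1 (hf h')).1)
      · exact absurd h (hfs _ _ _ hl)
      · exact absurd h' (hfs _ _ _ (hk' b hb _ hl))
      · exact absurd h.symm (hfs _ _ _ hk)
      · exact P.inv_injOn ha.1 hb.1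
          (hc _ (P.inv_mem a ha.1) _ (Prod.ext_iff.1 (hf h')).1)
      · exact absurd h.symm (hfs _ _ _ hk)
      · exact absurd h'.symm (hfs _ _ _ (hk' a ha _ hk))
      · exact absurd h (hfs _ _ _ hl)
      · exact hc a ha.1 b (Prod.ext_iff.1 (hf h)).1)
  have hQC : Q.carrier = C ∪ Set.range f := hC'.trans hC
  have hcard : Q.carrier.ncard = C.ncard + 7 ^ C.ncard * r := by
    rw [hQC, Set.ncard_union_eq _ hP (Set.finite_range f), ← Set.image_univ,
      Set.ncard_image_of_injective _ hf, Set.ncard_univ, Nat.card_prod, Nat.card_fun]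
    · simp [C]
    · rw [Set.disjoint_right]
      rintro _ ⟨p, rfl⟩
      exact hfC p
  have htotal : ∀ a ∈ A, ∀ n ∈ Q.carrier, (a, n) ∉ Q.dom → False := by
    intro a ha n hn hd
    suffices h : ∃ m, R a n m from hd (hd' _ _ _ h.choose_spec).1
    rw [hQC] at hn
    rcases hn with hn | ⟨p, rfl⟩
    · obtain ⟨k, hk, rfl⟩ := (hs a).surjOn
        (show n ∈ S a from ⟨hn, fun h => hd (hext'.2.1 (hext.2.1 h))⟩)
      exact ⟨_, ha, Or.inr (Or.inl ⟨⟨k, lt_of_lt_of_le hk (hgr a)⟩, hk, rfl, rfl⟩)⟩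
    · by_cases hp : ∃ k : Fin r, k.1 < g a ∧ p = (c a, k)
      · obtain ⟨k, hk, rfl⟩ := hp
        exact ⟨_, ha, Or.inr (Or.inr ⟨k, hk, rfl, rfl⟩)⟩
      · exact ⟨_, ha, Or.inl ⟨p, fun k hk h => hp ⟨k, hk, h⟩, rfl, rfl⟩⟩
  have hnA : ∀ x ∈ Q.carrier, x ∉ A → Q.inv x = x := by
    intro x hx hxA
    rw [hi']
    rw [hQC] at hx
    rcases hx with hx | hx
    · rw [hi x hx]
      by_contra h
      exact hxA ⟨hx, h⟩
    · exact hiN x hx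
  refine ⟨Q, ?_, hext.trans hext', hO3'.trans hO3, ?_, ?_, ?_⟩
  · rw [hQC]
    exact hP.union (Set.finite_range f)
  · have : 1 * r ≤ 7 ^ C.ncard * r := Nat.mul_le_mul_right _ (Nat.one_le_pow _ _ (by norm_num))
    rw [hcard]
    simp only [r] at this ⊢
    omega
  · have h7 : 7 ^ C.ncard % 6 = 1 := by simp [Nat.pow_mod]
    rw [hcard, Nat.add_mod, Nat.mul_mod, h7]
    simp only [r]
    omega
  · rintro ⟨x, y⟩ ⟨⟨hx, hy⟩, hxy⟩
    have hx1 : x ≠ Q.one := by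
      rintro rfl
      exact hxy (Q.one_mul_dom y hy)
    have hy1 : y ≠ Q.one := by
      rintro rfl
      exact hxy (Q.mul_one_dom x hx)
    refine ⟨Q.mem_O2_iff.2 ⟨hx, hx1, hnA x hx fun h => htotal x h y hy hxy⟩,
      Q.mem_O2_iff.2 ⟨hy, hy1, hnA y hy fun h => ?_⟩⟩
    have hinv : Q.inv y = P.inv y := by rw [hi', hi y h.1]
    refine htotal (Q.inv y) (hinv ▸ hAinv y h) (Q.inv x) (Q.inv_mem x hx) ?_
    rwa [Q.dom_rev_iff hx hy]

end PartialIPLoop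

/-- If `P` is a finite partial IP loop with `3 ∣ o₃(P)`, then there is a finite
partial IP loop `Q` extending `P` with `3 ∣ o₃(Q)`, `#Q ≥ 10`, `#Q ≡ 4 (mod 6)`
and `Γ(Q) ⊆ O₂(Q) × O₂(Q)`. -/
theorem exists_extension_cond4 {α : Type*} [Infinite α]
    (P : PartialIPLoop α) (hP : P.carrier.Finite) (h3 : 3 ∣ P.O3.ncard) :
    ∃ Q : PartialIPLoop α, Q.carrier.Finite ∧ P.Ext Q ∧
      3 ∣ Q.O3.ncard ∧ 10 ≤ Q.carrier.ncard ∧ Q.carrier.ncard % 6 = 4 ∧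
      Q.gaps ⊆ Q.O2 ×ˢ Q.O2 := by
  obtain ⟨P₁, hfin₁, hext₁, hO₁, hgap₁⟩ := P.exists_fill_non_involutions hP
  obtain ⟨Q, hfin, hext, hO, h10, h6, hgap⟩ := P₁.exists_fill_of_gaps hfin₁ hgap₁
  exact ⟨Q, hfin, hext₁.trans hext, by rwa [hO, hO₁], h10, h6, hgap⟩
end
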